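/- arXiv:2305.06192 — 8 statements merged into one kernel-verified Lean document; each statement's English description precedes it below -/
import Mathlib

section
/- Let d ≥ 3 and let F : EuclideanSpace ℝ (Fin d) → EuclideanSpace ℝ (Fin d) be a vector field each of whose components x ↦ ⟪e_j, F(x)⟫ is a Schwartz function. Let Φ = div F and define the potential φ(x) = ∫_{ℝ^d} Φ(y)·G(x−y) dy, where G(x) = −(Γ(d/2−1)/(4π^{d/2}))·‖x‖^{2−d}. Then there exists a constant C ≥ 0 such that |φ(x)| ≤ C·(1+‖x‖)^{1−d} for all x. -/
open MeasureTheory Real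
open scoped RealInnerProductSpace

noncomputable section

/-- The `j`-th canonical basis vector of `ℝ^d`. -/
def canE (d : ℕ) (j : Fin d) : EuclideanSpace ℝ (Fin d) := EuclideanSpace.single j 1

/-- Divergence of a vector field on `ℝ^d`: `div F x = ∑ⱼ ∂Fⱼ/∂xⱼ (x)`. -/
def vdiv {d : ℕ} (F : EuclideanSpace ℝ (Fin d) → EuclideanSpace ℝ (Fin d))
    (x : EuclideanSpace ℝ (Fin d)) : ℝ :=
  ∑ j, fderiv ℝ (fun y => ⟪canE d j, F y⟫) x (canE d j)

/-- Laplacian of a scalar function on `ℝ^d` (sum of second partial derivatives). -/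
def lap {d : ℕ} (f : EuclideanSpace ℝ (Fin d) → ℝ) (x : EuclideanSpace ℝ (Fin d)) : ℝ :=
  ∑ j, fderiv ℝ (fun y => fderiv ℝ f y (canE d j)) x (canE d j)

/-- A function is a Schwartz function if it agrees with an element of the Schwartz space. -/
def IsSchwartz {d : ℕ} (f : EuclideanSpace ℝ (Fin d) → ℝ) : Prop :=
  ∃ g : SchwartzMap (EuclideanSpace ℝ (Fin d)) ℝ, ∀ x, f x = g x

/-- The fundamental solution of the Laplace equation in `ℝ^d`, `d ≥ 3`:
`G(x) = −(Γ(d/2−1)/(4 π^{d/2})) ‖x‖^{2−d}`. -/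
def fundSol (d : ℕ) (x : EuclideanSpace ℝ (Fin d)) : ℝ :=
  -(Real.Gamma ((d : ℝ) / 2 - 1) / (4 * Real.pi ^ ((d : ℝ) / 2))) * ‖x‖ ^ ((2 : ℝ) - d)

/-- The Radon transform of a scalar function: integral over the hyperplane `⟪x,ω⟫ = p`,
parametrized as `x = p•ω + y`, `y ∈ (ℝ∙ω)ᗮ`. -/
def RadonT {d : ℕ} (f : EuclideanSpace ℝ (Fin d) → ℝ) (ω : EuclideanSpace ℝ (Fin d))
    (p : ℝ) : ℝ :=
  ∫ y : ((ℝ ∙ ω)ᗮ : Submodule ℝ (EuclideanSpace ℝ (Fin d))),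
    f (p • ω + (y : EuclideanSpace ℝ (Fin d)))

/-- The componentwise (vector-valued, Bochner) Radon transform of a vector field. -/
def RadonVec {d : ℕ} (F : EuclideanSpace ℝ (Fin d) → EuclideanSpace ℝ (Fin d))
    (ω : EuclideanSpace ℝ (Fin d)) (p : ℝ) : EuclideanSpace ℝ (Fin d) :=
  ∫ y : ((ℝ ∙ ω)ᗮ : Submodule ℝ (EuclideanSpace ℝ (Fin d))),
    F (p • ω + (y : EuclideanSpace ℝ (Fin d)))

/-- The transversal Radon transform `[D^⊥F](ω,p)`. -/
def Dperp {d : ℕ} (F : EuclideanSpace ℝ (Fin d) → EuclideanSpace ℝ (Fin d))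
    (ω : EuclideanSpace ℝ (Fin d)) (p : ℝ) : ℝ :=
  RadonT (fun x => ⟪ω, F x⟫) ω p

/-- The longitudinal Radon transform `[D_θ^∥F](ω,p)` for a direction `θ` orthogonal to `ω`. -/
def Dlong {d : ℕ} (F : EuclideanSpace ℝ (Fin d) → EuclideanSpace ℝ (Fin d))
    (ω θ : EuclideanSpace ℝ (Fin d)) (p : ℝ) : ℝ :=
  RadonT (fun x => ⟪θ, F x⟫) ω p

/-- The weighted transversal Radon transform `[W_θ^⊥F](ω,p)` with linear weight `⟪θ,x⟫`. -/
def Wperp {d : ℕ} (F : EuclideanSpace ℝ (Fin d) → EuclideanSpace ℝ (Fin d))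
    (ω θ : EuclideanSpace ℝ (Fin d)) (p : ℝ) : ℝ :=
  RadonT (fun x => ⟪θ, x⟫ * ⟪ω, F x⟫) ω p

/-- The weighted longitudinal Radon transform `[W_θ^∥F](ω,p)` with linear weight `⟪θ,x⟫`. -/
def Wlong {d : ℕ} (F : EuclideanSpace ℝ (Fin d) → EuclideanSpace ℝ (Fin d))
    (ω θ : EuclideanSpace ℝ (Fin d)) (p : ℝ) : ℝ :=
  RadonT (fun x => ⟪θ, x⟫ * ⟪θ, F x⟫) ω p

lemma aux_near_int (d : ℕ) (hd : 3 ≤ d) :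
    Integrable (Set.indicator (Metric.ball (0 : EuclideanSpace ℝ (Fin d)) 1)
      (fun z => ‖z‖ ^ ((2 : ℝ) - d))) := by
  have : Nonempty (Fin d) := ⟨⟨0, by omega⟩⟩
  have hdR : (3 : ℝ) ≤ d := by exact_mod_cast hd
  have h := (integrable_fun_norm_addHaar (E := EuclideanSpace ℝ (Fin d)) volume
    (f := Set.indicator (Set.Iio 1) (fun r : ℝ => r ^ ((2 : ℝ) - d)))).2 ?_
  · refine h.congr (Filter.Eventually.of_forall fun z => ?_)
    by_cases hz : ‖z‖ < 1 <;> simp [Set.indicator, hz]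
  · have h1 : IntegrableOn (Set.indicator (Set.Ioo (0:ℝ) 1) (fun _ => (1:ℝ))) (Set.Ioi 0) := by
      refine Integrable.integrableOn ?_
      exact (integrable_indicator_iff measurableSet_Ioo).2 (by simp)
    refine Integrable.mono' h1 ?_ ?_
    · refine Measurable.aestronglyMeasurable ?_
      exact (measurable_id.pow_const _).smul
        ((measurable_id.pow_const _).indicator measurableSet_Iio)
    · filter_upwards [ae_restrict_mem measurableSet_Ioi] with y hy
      have hy : 0 < y := hy
      by_cases h1 : y < 1
      · simp only [Set.indicator, Set.mem_Iio, h1, Set.mem_Ioo, hy, and_self, if_true,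
          finrank_euclideanSpace, Fintype.card_fin, smul_eq_mul]
        rw [← Real.rpow_natCast, ← Real.rpow_add hy, Real.norm_of_nonneg (by positivity)]
        refine Real.rpow_le_one hy.le h1.le ?_
        rw [Nat.cast_sub (by omega)]
        norm_num
      · simp [Set.indicator, h1]

lemma aux_w_int (d : ℕ) :
    Integrable (fun y : EuclideanSpace ℝ (Fin d) => (1 + ‖y‖) ^ (-((d : ℝ) + 1))) :=
  integrable_one_add_norm (by simp)

lemma aux_A (d : ℕ) (hd : 3 ≤ d) : ∃ A : ℝ, 0 ≤ A ∧ ∀ x : EuclideanSpace ℝ (Fin d),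
    Integrable (fun y => (1 + ‖y‖) ^ (-((d : ℝ) + 1)) * ‖x - y‖ ^ ((2 : ℝ) - d)) ∧
    ∫ y, (1 + ‖y‖) ^ (-((d : ℝ) + 1)) * ‖x - y‖ ^ ((2 : ℝ) - d) ≤ A := by
  have hdR : (3 : ℝ) ≤ d := by exact_mod_cast hd
  set J := Set.indicator (Metric.ball (0 : EuclideanSpace ℝ (Fin d)) 1)
      (fun z => ‖z‖ ^ ((2 : ℝ) - d)) with hJ
  have hJi : Integrable J := aux_near_int d hd
  have hJ0 : ∀ z, 0 ≤ J z := fun z => Set.indicator_nonneg (fun _ _ => by positivity) _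
  refine ⟨(∫ z, J z) + ∫ y : EuclideanSpace ℝ (Fin d), (1 + ‖y‖) ^ (-((d : ℝ) + 1)), ?_, ?_⟩
  · exact add_nonneg (integral_nonneg hJ0) (integral_nonneg fun _ => by positivity)
  intro x
  have hle : ∀ y, (1 + ‖y‖) ^ (-((d : ℝ) + 1)) * ‖x - y‖ ^ ((2 : ℝ) - d) ≤
      J (x - y) + (1 + ‖y‖) ^ (-((d : ℝ) + 1)) := by
    intro y
    have hw0 : 0 ≤ (1 + ‖y‖) ^ (-((d : ℝ) + 1)) := by positivity
    have hw1 : (1 + ‖y‖) ^ (-((d : ℝ) + 1)) ≤ 1 :=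
      Real.rpow_le_one_of_one_le_of_nonpos (by linarith [norm_nonneg y]) (by linarith)
    by_cases hz : ‖x - y‖ < 1
    · have : J (x - y) = ‖x - y‖ ^ ((2 : ℝ) - d) := by
        simp [hJ, hz]
      rw [this]
      have : 0 ≤ ‖x - y‖ ^ ((2 : ℝ) - d) := by positivity
      nlinarith
    · have h2 : ‖x - y‖ ^ ((2 : ℝ) - d) ≤ 1 :=
        Real.rpow_le_one_of_one_le_of_nonpos (not_lt.1 hz) (by linarith)
      have := hJ0 (x - y)
      nlinarith
  have hJx : Integrable (fun y => J (x - y)) := hJi.comp_sub_left x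
  have hi := hJx.add (aux_w_int d)
  have hI : Integrable (fun y => (1 + ‖y‖) ^ (-((d : ℝ) + 1)) * ‖x - y‖ ^ ((2 : ℝ) - d)) := by
    refine hi.mono' (Measurable.aestronglyMeasurable (by fun_prop)) ?_
    refine Filter.Eventually.of_forall fun y => ?_
    rw [Real.norm_of_nonneg (by positivity)]
    exact hle y
  refine ⟨hI, ?_⟩
  calc _ ≤ ∫ y, (J (x - y) + (1 + ‖y‖) ^ (-((d : ℝ) + 1))) := integral_mono hI hi hle
    _ = _ := by
      rw [integral_add hJx (aux_w_int d), integral_sub_left_eq_self J volume x]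

lemma aux_lip (d : ℕ) (hd : 3 ≤ d) (r : ℝ) (hr : 0 < r) (a b : ℝ) :
    |max a r ^ ((2 : ℝ) - d) - max b r ^ ((2 : ℝ) - d)| ≤
      ((d : ℝ) - 2) * r ^ ((1 : ℝ) - d) * |a - b| := by
  have hdR : (3 : ℝ) ≤ d := by exact_mod_cast hd
  have h := Convex.norm_image_sub_le_of_norm_hasDerivWithin_le (s := Set.Ici r)
    (f := fun u : ℝ => u ^ ((2 : ℝ) - d)) (f' := fun u => ((2 : ℝ) - d) * u ^ ((2 : ℝ) - d - 1))
    (C := ((d : ℝ) - 2) * r ^ ((1 : ℝ) - d)) (x := max b r) (y := max a r)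
    (fun u hu => (Real.hasDerivAt_rpow_const (Or.inl (hr.trans_le hu).ne')).hasDerivWithinAt)
    (fun u hu => ?_) (convex_Ici r)
    (Set.mem_Ici.2 (le_max_right _ _)) (Set.mem_Ici.2 (le_max_right _ _))
  · simp only [Real.norm_eq_abs] at h
    refine h.trans ?_
    have : 0 ≤ ((d : ℝ) - 2) * r ^ ((1 : ℝ) - d) := mul_nonneg (by linarith) (by positivity)
    refine mul_le_mul_of_nonneg_left ?_ this
    simpa using abs_max_sub_max_le_abs a b r
  · have hu : r ≤ u := hu
    have hu0 := hr.trans_le hu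
    rw [norm_mul, Real.norm_eq_abs, Real.norm_eq_abs, abs_of_nonpos (by linarith),
      abs_of_nonneg (by positivity)]
    rw [show (2 : ℝ) - d - 1 = 1 - d by ring, neg_sub]
    exact mul_le_mul_of_nonneg_left (Real.rpow_le_rpow_of_nonpos hr hu (by linarith)) (by linarith)

lemma aux_decay (d k : ℕ) (g : SchwartzMap (EuclideanSpace ℝ (Fin d)) ℝ) :
    ∃ C, 0 ≤ C ∧ ∀ y, ‖fderiv ℝ g y‖ ≤ C * (1 + ‖y‖) ^ (-(k : ℝ)) := by
  refine ⟨2 ^ k * (Finset.Iic (k, 1)).sup (fun m => SchwartzMap.seminorm ℝ m.1 m.2) g,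
    by positivity, fun y => ?_⟩
  have h := SchwartzMap.one_add_le_sup_seminorm_apply (𝕜 := ℝ) (m := (k, 1)) (k := k) (n := 1)
    le_rfl le_rfl g y
  rw [norm_iteratedFDeriv_one] at h
  have hp : 0 < (1 + ‖y‖) := by positivity
  rw [Real.rpow_neg hp.le, Real.rpow_natCast, ← div_eq_mul_inv, le_div_iff₀ (by positivity),
    mul_comm]
  exact h

lemma aux_parts (d : ℕ) (g : SchwartzMap (EuclideanSpace ℝ (Fin d)) ℝ)
    (K : EuclideanSpace ℝ (Fin d) → ℝ) (hK : Continuous K) (M L : ℝ) (hL : 0 ≤ L)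
    (hM : ∀ z, |K z| ≤ M) (hKL : ∀ z z', |K z - K z'| ≤ L * ‖z - z'‖)
    (e : EuclideanSpace ℝ (Fin d)) (he : ‖e‖ = 1) (x : EuclideanSpace ℝ (Fin d)) :
    Integrable (fun y => fderiv ℝ g y e * K (x - y)) ∧
    |∫ y, fderiv ℝ g y e * K (x - y)| ≤ L * ∫ y, |g y| := by
  obtain ⟨C, hC0, hC⟩ := aux_decay d (d + 1) g
  have hM0 : 0 ≤ M := (abs_nonneg _).trans (hM 0)
  have hKx : Continuous fun y => K (x - y) := hK.comp (by fun_prop)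
  have hgi : ∀ t : ℝ, Integrable (fun y => g (y + t • e)) := fun t =>
    g.integrable.comp_add_right (t • e)
  have hfd : Continuous (fun y => fderiv ℝ g y e) :=
    ((g.smooth 1).continuous_fderiv one_ne_zero).clm_apply continuous_const
  have key := hasDerivAt_integral_of_dominated_loc_of_deriv_le (μ := volume) (x₀ := (0:ℝ))
    (s := Metric.ball 0 1)
    (F := fun (t : ℝ) y => g (y + t • e) * K (x - y))
    (F' := fun (t : ℝ) y => fderiv ℝ g (y + t • e) e * K (x - y))
    (bound := fun y => C * 2 ^ ((d : ℝ) + 1) * M * (1 + ‖y‖) ^ (-((d : ℝ) + 1)))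
    (Metric.ball_mem_nhds _ one_pos)
    (Filter.Eventually.of_forall fun t =>
      ((g.continuous.comp (by fun_prop)).mul hKx).aestronglyMeasurable)
    ((hgi 0).mul_bdd (c := M) hKx.aestronglyMeasurable (Filter.Eventually.of_forall fun y => hM _))
    ((hfd.comp (by fun_prop)).mul hKx).aestronglyMeasurable
    (Filter.Eventually.of_forall fun y t ht => ?_)
    ((aux_w_int d).const_mul _)
    (Filter.Eventually.of_forall fun y t ht => ?_)
  · simp only [zero_smul, add_zero] at key
    refine ⟨key.1, ?_⟩
    refine key.2.le_of_lip' (mul_nonneg hL (integral_nonneg fun _ => abs_nonneg _))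
      (Filter.Eventually.of_forall fun t => ?_)
    have hb : ∀ t : ℝ, Integrable (fun y => g y * K (x - y + t • e)) := fun t =>
      g.integrable.mul_bdd (c := M) (hK.comp (by fun_prop)).aestronglyMeasurable
        (Filter.Eventually.of_forall fun y => hM _)
    have hs : ∀ t : ℝ, ∫ y, g (y + t • e) * K (x - y) = ∫ y, g y * K (x - y + t • e) := by
      intro t
      rw [← integral_add_right_eq_self (fun y => g y * K (x - y + t • e)) (t • e)]
      congr 1; ext y; congr 2; abel
    have hb0 := hb 0
    simp only [zero_smul, add_zero] at hb0 ⊢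
    rw [hs t, ← integral_sub (hb t) hb0]
    have hgabs : Integrable (fun y => |g y|) := g.integrable.abs
    refine (norm_integral_le_of_norm_le (hgabs.const_mul (L * ‖t‖))
      (Filter.Eventually.of_forall fun y => ?_)).trans ?_
    · rw [← mul_sub, norm_mul, mul_comm]
      have := hKL (x - y + t • e) (x - y)
      rw [add_sub_cancel_left, norm_smul, he, mul_one] at this
      exact mul_le_mul_of_nonneg_right this (abs_nonneg _)
    · rw [integral_const_mul, sub_zero]
      apply le_of_eq; ring
  · have ht : ‖t‖ < 1 := by simpa using ht
    have h1 : ‖y‖ ≤ ‖y + t • e‖ + 1 := by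
      have := norm_sub_le (y + t • e) (t • e)
      rw [add_sub_cancel_right, norm_smul, he, mul_one] at this
      linarith
    have h2 : (1 + ‖y‖) / 2 ≤ 1 + ‖y + t • e‖ := by
      linarith [norm_nonneg (y + t • e)]
    have h3 := hC (y + t • e)
    push_cast at h3
    have h4 : (1 + ‖y + t • e‖) ^ (-((d : ℝ) + 1)) ≤
        2 ^ ((d : ℝ) + 1) * (1 + ‖y‖) ^ (-((d : ℝ) + 1)) := by
      refine (Real.rpow_le_rpow_of_nonpos (by positivity) h2 (by linarith)).trans ?_
      rw [Real.div_rpow (by positivity) (by positivity), Real.rpow_neg zero_le_two, div_inv_eq_mul,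
        mul_comm]
    rw [norm_mul]
    have h5 : ‖fderiv ℝ g (y + t • e) e‖ ≤ ‖fderiv ℝ g (y + t • e)‖ := by
      simpa [he] using (fderiv ℝ g (y + t • e)).le_opNorm e
    calc _ ≤ (C * (2 ^ ((d : ℝ) + 1) * (1 + ‖y‖) ^ (-((d : ℝ) + 1)))) * M :=
          mul_le_mul ((h5.trans h3).trans (mul_le_mul_of_nonneg_left h4 hC0)) (hM _) (abs_nonneg _)
            (by positivity)
      _ = _ := by ring
  · refine HasDerivAt.mul_const ?_ _
    have h1 : HasDerivAt (fun t : ℝ => y + t • e) e t := by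
      simpa using ((hasDerivAt_id t).smul_const e).const_add y
    exact (g.differentiableAt.hasFDerivAt).comp_hasDerivAt t h1

lemma aux_main (d : ℕ) (hd : 3 ≤ d) (g : SchwartzMap (EuclideanSpace ℝ (Fin d)) ℝ)
    (e : EuclideanSpace ℝ (Fin d)) (he : ‖e‖ = 1) :
    ∃ C, 0 ≤ C ∧ ∀ x : EuclideanSpace ℝ (Fin d),
      Integrable (fun y => fderiv ℝ g y e * ‖x - y‖ ^ ((2 : ℝ) - d)) ∧
      |∫ y, fderiv ℝ g y e * ‖x - y‖ ^ ((2 : ℝ) - d)| ≤ C * (1 + ‖x‖) ^ ((1 : ℝ) - d) := by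
  have : Nonempty (Fin d) := ⟨⟨0, by omega⟩⟩
  have hdR : (3 : ℝ) ≤ d := by exact_mod_cast hd
  obtain ⟨A, hA0, hA⟩ := aux_A d hd
  obtain ⟨D, hD0, hD⟩ := aux_decay d (2 * d) g
  have hI0 : 0 ≤ ∫ y, |g y| := integral_nonneg fun _ => abs_nonneg _
  have hfd : Continuous (fun y => fderiv ℝ g y e) :=
    ((g.smooth 1).continuous_fderiv one_ne_zero).clm_apply continuous_const
  have h2 : (0:ℝ) ≤ 2⁻¹ ^ ((1 : ℝ) - d) := by positivity
  refine ⟨((d : ℝ) - 2) * 2⁻¹ ^ ((1 : ℝ) - d) * (∫ y, |g y|) + D * 2⁻¹ ^ ((1 : ℝ) - d) * A,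
    ?_, fun x => ?_⟩
  · have : (0:ℝ) ≤ d - 2 := by linarith
    positivity
  have hx0 : 0 < 1 + ‖x‖ := by positivity
  set r : ℝ := 2⁻¹ * (1 + ‖x‖) with hr
  have hr0 : 0 < r := by positivity
  have hrp : r ^ ((1 : ℝ) - d) = 2⁻¹ ^ ((1 : ℝ) - d) * (1 + ‖x‖) ^ ((1 : ℝ) - d) :=
    Real.mul_rpow (by positivity) hx0.le
  have hDw : ∀ y, |fderiv ℝ g y e| ≤
      D * ((1 + ‖y‖) ^ (-((d : ℝ) + 1)) * (1 + ‖y‖) ^ ((1 : ℝ) - d)) := by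
    intro y
    have h5 : ‖fderiv ℝ g y e‖ ≤ ‖fderiv ℝ g y‖ := by
      simpa [he] using (fderiv ℝ g y).le_opNorm e
    refine h5.trans ((hD y).trans_eq ?_)
    rw [← Real.rpow_add (by positivity)]
    congr 2; push_cast; ring
  set K : EuclideanSpace ℝ (Fin d) → ℝ := fun z => max ‖z‖ r ^ ((2 : ℝ) - d) with hKdef
  have hKc : Continuous K := (continuous_norm.max continuous_const).rpow_const
    fun z => Or.inl (hr0.trans_le (le_max_right _ _)).ne'
  have hK0 : ∀ z, 0 ≤ K z := fun z => Real.rpow_nonneg (hr0.le.trans (le_max_right _ _)) _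
  obtain ⟨hi1, hb1⟩ := aux_parts d g K hKc (r ^ ((2 : ℝ) - d)) (((d : ℝ) - 2) * r ^ ((1 : ℝ) - d))
    (mul_nonneg (by linarith) (by positivity))
    (fun z => by
      rw [abs_of_nonneg (hK0 z)]
      exact Real.rpow_le_rpow_of_nonpos hr0 (le_max_right _ _) (by linarith))
    (fun z z' => (aux_lip d hd r hr0 _ _).trans
      (mul_le_mul_of_nonneg_left (abs_norm_sub_norm_le z z')
        (mul_nonneg (by linarith) (by positivity)))) e he x
  have hae : ∀ᵐ y : EuclideanSpace ℝ (Fin d), y ≠ x := Measure.ae_ne volume x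
  have hbd : ∀ᵐ y, ‖fderiv ℝ g y e * (‖x - y‖ ^ ((2 : ℝ) - d) - K (x - y))‖ ≤
      D * r ^ ((1 : ℝ) - d) * ((1 + ‖y‖) ^ (-((d : ℝ) + 1)) * ‖x - y‖ ^ ((2 : ℝ) - d)) := by
    filter_upwards [hae] with y hy
    have hz : 0 < ‖x - y‖ := norm_pos_iff.2 (sub_ne_zero.2 hy.symm)
    by_cases hzr : r ≤ ‖x - y‖
    · have : K (x - y) = ‖x - y‖ ^ ((2 : ℝ) - d) := by simp [hKdef, max_eq_left hzr]
      rw [this, sub_self, mul_zero, norm_zero]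
      positivity
    · push Not at hzr
      have hKle : K (x - y) ≤ ‖x - y‖ ^ ((2 : ℝ) - d) :=
        Real.rpow_le_rpow_of_nonpos hz (le_max_left _ _) (by linarith)
      have hry : r ≤ 1 + ‖y‖ := by
        have : ‖x‖ ≤ ‖x - y‖ + ‖y‖ := by simpa using norm_add_le (x - y) y
        linarith
      rw [norm_mul, Real.norm_eq_abs, Real.norm_eq_abs, abs_of_nonneg (sub_nonneg.2 hKle)]
      have h1 : |fderiv ℝ g y e| ≤ D * ((1 + ‖y‖) ^ (-((d : ℝ) + 1)) * r ^ ((1 : ℝ) - d)) := by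
        refine (hDw y).trans ?_
        gcongr ?_ * (?_ * ?_)
        exact Real.rpow_le_rpow_of_nonpos hr0 hry (by linarith)
      calc _ ≤ (D * ((1 + ‖y‖) ^ (-((d : ℝ) + 1)) * r ^ ((1 : ℝ) - d))) *
            ‖x - y‖ ^ ((2 : ℝ) - d) :=
            mul_le_mul h1 (by linarith [hK0 (x - y)]) (by linarith) (by positivity)
        _ = _ := by ring
  have hdom := (hA x).1.const_mul (D * r ^ ((1 : ℝ) - d))
  have hi2 : Integrable (fun y => fderiv ℝ g y e * (‖x - y‖ ^ ((2 : ℝ) - d) - K (x - y))) := by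
    refine hdom.mono' (Measurable.aestronglyMeasurable ?_) hbd
    exact hfd.measurable.mul (Measurable.sub (by fun_prop)
      (hKc.measurable.comp (by fun_prop)))
  have heq : (fun y => fderiv ℝ g y e * ‖x - y‖ ^ ((2 : ℝ) - d)) =
      fun y => fderiv ℝ g y e * K (x - y) +
        fderiv ℝ g y e * (‖x - y‖ ^ ((2 : ℝ) - d) - K (x - y)) := by
    ext y; ring
  rw [heq]
  refine ⟨hi1.add hi2, ?_⟩
  rw [integral_add hi1 hi2]
  have hb2 := norm_integral_le_of_norm_le hdom hbd
  rw [integral_const_mul, Real.norm_eq_abs] at hb2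
  have hb3 := mul_le_mul_of_nonneg_left (hA x).2 (show 0 ≤ D * r ^ ((1 : ℝ) - d) by positivity)
  refine (abs_add_le _ _).trans ((add_le_add hb1 (hb2.trans hb3)).trans_eq ?_)
  rw [hrp]; ring

/-- decay of the Newtonian potential of the divergence of a Schwartz
vector field: `|φ(x)| ≤ C (1+‖x‖)^{1−d}`. -/
theorem stmt1 (d : ℕ) (hd : 3 ≤ d)
    (F : EuclideanSpace ℝ (Fin d) → EuclideanSpace ℝ (Fin d))
    (hF : ∀ j : Fin d, IsSchwartz (fun x => ⟪canE d j, F x⟫))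
    (Φ : EuclideanSpace ℝ (Fin d) → ℝ) (hΦ : ∀ x, Φ x = vdiv F x)
    (φ : EuclideanSpace ℝ (Fin d) → ℝ)
    (hφ : ∀ x, φ x = ∫ y, Φ y * fundSol d (x - y)) :
    ∃ C, 0 ≤ C ∧ ∀ x, |φ x| ≤ C * (1 + ‖x‖) ^ ((1 : ℝ) - d) := by
  have hch : ∀ j, ∃ g : SchwartzMap (EuclideanSpace ℝ (Fin d)) ℝ,
      (fun x => ⟪canE d j, F x⟫) = g := fun j => by
    obtain ⟨g, hg⟩ := hF j
    exact ⟨g, funext hg⟩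
  choose g hg using hch
  have he : ∀ j, ‖canE d j‖ = 1 := fun j => by simp [canE]
  choose C hC0 hC using fun j => aux_main d hd (g j) (canE d j) (he j)
  set c : ℝ := -(Real.Gamma ((d : ℝ) / 2 - 1) / (4 * Real.pi ^ ((d : ℝ) / 2))) with hc
  refine ⟨|c| * ∑ j, C j,
    mul_nonneg (abs_nonneg _) (Finset.sum_nonneg fun j _ => hC0 j), fun x => ?_⟩
  have h1 : φ x = c * ∑ j, ∫ y, fderiv ℝ (g j) y (canE d j) * ‖x - y‖ ^ ((2 : ℝ) - d) := by
    rw [hφ, ← integral_finsetSum _ (fun j _ => (hC j x).1), ← integral_const_mul]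
    congr 1; ext y
    rw [hΦ, vdiv, fundSol, ← hc, ← Finset.sum_mul]
    simp only [hg]
    ring
  rw [h1, abs_mul, mul_assoc, Finset.sum_mul]
  refine mul_le_mul_of_nonneg_left ?_ (abs_nonneg _)
  exact (Finset.abs_sum_le_sum_abs _ _).trans (Finset.sum_le_sum fun j _ => (hC j x).2)
end
end

section
/- Let d ≥ 3 and let F : EuclideanSpace ℝ (Fin d) → EuclideanSpace ℝ (Fin d) be a vector field each of whose components x ↦ ⟪e_j, F(x)⟫ is a Schwartz function. Let Φ = div F and φ(x) = ∫_{ℝ^d} Φ(y)·G(x−y) dy, where G(x) = −(Γ(d/2−1)/(4π^{d/2}))·‖x‖^{2−d}. Then φ is differentiable on ℝ^d and there exists a constant C ≥ 0 such that ‖∇φ(x)‖ ≤ C·(1+‖x‖)^{-d} for all x; consequently the potential part F^p = ∇φ and the solenoidal part F^s = F − ∇φ both satisfy ‖F^p(x)‖ ≤ C·(1+‖x‖)^{-d} and ‖F^s(x)‖ ≤ C'·(1+‖x‖)^{-d}. -/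
open MeasureTheory Real
open scoped RealInnerProductSpace

noncomputable section

namespace Aux
open scoped SchwartzMap LineDeriv

/-- Ambient space of dimension `m + 2`. -/
abbrev EE (m : ℕ) := EuclideanSpace ℝ (Fin (m + 2))

/-- Newtonian kernel. -/
def NN (m : ℕ) (y : EE m) : ℝ := (‖y‖ ^ m)⁻¹

/-- Integrable weight. -/
def ww (m : ℕ) (y : EE m) : ℝ := ((1 + ‖y‖) ^ (m + 3))⁻¹

lemma ww_nonneg (m : ℕ) (y : EE m) : 0 ≤ ww m y := by unfold ww; positivity

lemma ww_le_one (m : ℕ) (y : EE m) : ww m y ≤ 1 := by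
  unfold ww
  apply inv_le_one_of_one_le₀
  apply one_le_pow₀
  linarith [norm_nonneg y]

lemma NN_nonneg (m : ℕ) (y : EE m) : 0 ≤ NN m y := by unfold NN; positivity

lemma NN_meas (m : ℕ) : Measurable (NN m) := by unfold NN; fun_prop

lemma ww_int (m : ℕ) : Integrable (ww m) := by
  have h := integrable_one_add_norm (E := EE m) (μ := volume) (r := (m : ℝ) + 3)
    (by simp; linarith)
  refine h.congr (Filter.Eventually.of_forall fun y => ?_)
  have : (0 : ℝ) ≤ 1 + ‖y‖ := by positivity
  simp only [ww]
  rw [Real.rpow_neg this]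
  congr 1
  rw [← Real.rpow_natCast]
  push_cast
  rfl

/-- Local part of the kernel. -/
def N1 (m : ℕ) : EE m → ℝ := (Metric.ball (0 : EE m) 1).indicator (NN m)

lemma N1_int (m : ℕ) : Integrable (N1 m) := by
  unfold N1
  rw [integrable_indicator_iff measurableSet_ball]
  have := (integrableOn_fun_norm_addHaar (E := EE m) (volume) (f := fun r : ℝ => (r ^ m)⁻¹)
    (r := 1)).2 ?_
  · exact this
  · have hc : IntegrableOn (fun y : ℝ => y) (Set.Ioo 0 1) :=
      (continuous_id.integrableOn_Icc (a := (0:ℝ)) (b := 1)).mono_set Set.Ioo_subset_Icc_self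
    refine hc.congr_fun (fun y hy => ?_) measurableSet_Ioo
    have : y ≠ 0 := hy.1.ne'
    simp
    field_simp
    ring

lemma N1_nonneg (m : ℕ) (y : EE m) : 0 ≤ N1 m y := by
  unfold N1; exact Set.indicator_nonneg (fun y _ => NN_nonneg m y) y

lemma NN_le (m : ℕ) (y : EE m) : NN m y ≤ N1 m y + 1 := by
  unfold N1
  by_cases h : y ∈ Metric.ball (0 : EE m) 1
  · simp [h]
  · simp [h, NN]
    apply inv_le_one_of_one_le₀
    apply one_le_pow₀
    simpa using h

lemma Nw_int (m : ℕ) : Integrable (fun y => ww m y * (1 + NN m y)) := by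
  refine ((N1_int m).add ((ww_int m).const_mul 2)).mono' ?_ (Filter.Eventually.of_forall fun y => ?_)
  · have := NN_meas m
    unfold ww
    fun_prop
  · have h1 := ww_nonneg m y
    have h2 := ww_le_one m y
    have h3 := NN_nonneg m y
    have h4 := NN_le m y
    have h5 := N1_nonneg m y
    rw [Real.norm_of_nonneg (by positivity)]
    simp only [Pi.add_apply]
    nlinarith

lemma peetre (m : ℕ) (x y : EE m) : 1 + ‖x‖ ≤ (1 + ‖x - y‖) * (1 + ‖y‖) := by
  have : ‖x‖ ≤ ‖x - y‖ + ‖y‖ := by simpa using norm_add_le (x - y) y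
  nlinarith [norm_nonneg (x - y), norm_nonneg y]

lemma peetre' (m : ℕ) (x y : EE m) : 1 + ‖y‖ ≤ (1 + ‖x - y‖) * (1 + ‖x‖) := by
  have := peetre m y x
  rwa [norm_sub_rev] at this

lemma ww_shift (m : ℕ) (x y : EE m) : ww m (x - y) ≤ (1 + ‖x‖) ^ (m + 3) * ww m y := by
  unfold ww
  rw [← div_eq_mul_inv, inv_eq_one_div, div_le_div_iff₀ (by positivity) (by positivity), one_mul,
    ← mul_pow]
  gcongr
  have := peetre' m x y
  linarith

/-- Uniform bound for a convolution. -/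
lemma conv_w (m : ℕ) (x : EE m) : Integrable (fun y => ww m (x - y) * (1 + NN m y)) ∧
    ∫ y, ww m (x - y) * (1 + NN m y) ≤ (∫ y, N1 m y) + 2 * ∫ y, ww m y := by
  have hw : Integrable (fun y => ww m (x - y)) := (ww_int m).comp_sub_left x
  have hdom : Integrable (fun y => N1 m y + 2 * ww m (x - y)) :=
    (N1_int m).add (hw.const_mul 2)
  have hle : ∀ y, ww m (x - y) * (1 + NN m y) ≤ N1 m y + 2 * ww m (x - y) := by
    intro y
    have h1 := ww_nonneg m (x - y)
    have h2 := ww_le_one m (x - y)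
    have h4 := NN_le m y
    have h5 := N1_nonneg m y
    nlinarith
  have hint : Integrable (fun y => ww m (x - y) * (1 + NN m y)) := by
    refine hdom.mono' ?_ (Filter.Eventually.of_forall fun y => ?_)
    · have := NN_meas m
      unfold ww
      fun_prop
    · have h1 := ww_nonneg m (x - y)
      have h3 := NN_nonneg m y
      rw [Real.norm_of_nonneg (by positivity)]
      exact hle y
  refine ⟨hint, ?_⟩
  calc _ ≤ ∫ y, (N1 m y + 2 * ww m (x - y)) := integral_mono hint hdom hle
    _ = _ := by
      rw [integral_add (N1_int m) (hw.const_mul 2), integral_const_mul,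
        integral_sub_left_eq_self (ww m) volume x]

lemma schw (m : ℕ) (V : Type*) [NormedAddCommGroup V] [NormedSpace ℝ V]
    (f : 𝓢(EE m, V)) (k : ℕ) : ∃ C, 0 ≤ C ∧ ∀ x, (1 + ‖x‖) ^ k * ‖f x‖ ≤ C := by
  have key := fun x => SchwartzMap.one_add_le_sup_seminorm_apply (𝕜 := ℝ) (m := (k, 0)) (k := k)
    (n := 0) le_rfl le_rfl f x
  simp only [norm_iteratedFDeriv_zero] at key
  exact ⟨_, le_trans (by positivity) (key 0), key⟩

lemma le_ww (m : ℕ) {t C : ℝ} (z : EE m) (h : (1 + ‖z‖) ^ (m + 3) * t ≤ C) : t ≤ C * ww m z := by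
  unfold ww
  rw [← div_eq_mul_inv, le_div_iff₀ (by positivity)]
  linarith

lemma conv_bound (m : ℕ) (f : 𝓢(EE m, ℝ)) (k : EE m → ℝ) (C' : ℝ) (hC' : 0 ≤ C')
    (hk : ∀ y, |k y| * (1 + ‖y‖) ^ (m + 2) ≤ C' * (1 + NN m y)) :
    ∃ C, 0 ≤ C ∧ ∀ x, |∫ y, f (x - y) * k y| * (1 + ‖x‖) ^ (m + 2) ≤ C := by
  obtain ⟨C, hC, hf⟩ := schw m ℝ f (m + 2 + (m + 3))
  refine ⟨C * C' * ((∫ y, N1 m y) + 2 * ∫ y, ww m y), ?_, fun x => ?_⟩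
  · have := integral_nonneg (μ := volume) (f := ww m) (fun y => ww_nonneg m y)
    have := integral_nonneg (μ := volume) (f := N1 m) (fun y => N1_nonneg m y)
    positivity
  obtain ⟨hi, hb⟩ := conv_w m x
  have e : |∫ y, f (x - y) * k y| * (1 + ‖x‖) ^ (m + 2)
      = ‖∫ y, (f (x - y) * k y) * (1 + ‖x‖) ^ (m + 2)‖ := by
    rw [integral_mul_const, norm_mul, Real.norm_eq_abs, Real.norm_of_nonneg (by positivity)]
  rw [e]
  calc _ ≤ ∫ y, C * C' * (ww m (x - y) * (1 + NN m y)) := by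
        refine norm_integral_le_of_norm_le (hi.const_mul _) (Filter.Eventually.of_forall fun y => ?_)
        rw [norm_mul, norm_mul, Real.norm_of_nonneg (by positivity : 0 ≤ (1 + ‖x‖) ^ (m + 2))]
        have h1 : (1 + ‖x‖) ^ (m + 2) ≤ (1 + ‖x - y‖) ^ (m + 2) * (1 + ‖y‖) ^ (m + 2) := by
          rw [← mul_pow]
          gcongr
          exact peetre m x y
        have h2 : (1 + ‖x - y‖) ^ (m + 2) * ‖f (x - y)‖ ≤ C * ww m (x - y) := by
          apply le_ww
          rw [← mul_assoc, ← pow_add, add_comm (m + 3)]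
          exact hf _
        have h3 := hk y
        calc ‖f (x - y)‖ * ‖k y‖ * (1 + ‖x‖) ^ (m + 2)
            ≤ ‖f (x - y)‖ * ‖k y‖ * ((1 + ‖x - y‖) ^ (m + 2) * (1 + ‖y‖) ^ (m + 2)) := by gcongr
          _ = ((1 + ‖x - y‖) ^ (m + 2) * ‖f (x - y)‖) * (|k y| * (1 + ‖y‖) ^ (m + 2)) := by
              rw [Real.norm_eq_abs (k y)]; ring
          _ ≤ (C * ww m (x - y)) * (C' * (1 + NN m y)) := by
              have := ww_nonneg m (x - y)
              gcongr
          _ = _ := by ring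
    _ ≤ _ := by
        rw [integral_const_mul]
        gcongr

lemma conv_int (m : ℕ) (f : 𝓢(EE m, ℝ)) (k : EE m → ℝ) (C' : ℝ)
    (hkm : Measurable k) (hk : ∀ y, |k y| ≤ C' * (1 + NN m y)) (x : EE m) :
    Integrable (fun y => f (x - y) * k y) := by
  obtain ⟨C, hC, hf⟩ := schw m ℝ f (m + 3)
  obtain ⟨hi, hb⟩ := conv_w m x
  refine (hi.const_mul (C * C')).mono' ?_ (Filter.Eventually.of_forall fun y => ?_)
  · have : Continuous fun y => f (x - y) := f.continuous.comp (by fun_prop)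
    fun_prop
  · rw [norm_mul]
    calc _ ≤ (C * ww m (x - y)) * (C' * (1 + NN m y)) := by
          have := ww_nonneg m (x - y)
          gcongr
          · exact le_ww m _ (hf _)
          · exact hk y
      _ = _ := by ring

/-- Differentiation of the potential. -/
lemma conv_deriv (m : ℕ) (f : 𝓢(EE m, ℝ)) (x₀ : EE m) :
    HasFDerivAt (fun x => ∫ y, f (x - y) * NN m y)
      (∫ y, NN m y • fderiv ℝ f (x₀ - y)) x₀ ∧
    Integrable (fun y => NN m y • fderiv ℝ f (x₀ - y)) := by
  obtain ⟨C, hC, hf⟩ := schw m _ (SchwartzMap.fderivCLM ℝ (EE m) ℝ f) (m + 3)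
  have hf' : ∀ x, (1 + ‖x‖) ^ (m + 3) * ‖fderiv ℝ f x‖ ≤ C := hf
  have hcont : Continuous (fderiv ℝ f) := (SchwartzMap.fderivCLM ℝ (EE m) ℝ f).continuous
  have hN := NN_meas m
  have hbd : ∀ y, ∀ x ∈ Metric.ball x₀ 1, ‖NN m y • fderiv ℝ f (x - y)‖ ≤
      (C * (2 + ‖x₀‖) ^ (m + 3)) * (ww m y * (1 + NN m y)) := by
    intro y x hx
    have hx' : ‖x‖ ≤ 1 + ‖x₀‖ := by
      have h1 : ‖x - x₀‖ < 1 := by simpa [dist_eq_norm] using hx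
      have : ‖x‖ ≤ ‖x - x₀‖ + ‖x₀‖ := by simpa using norm_add_le (x - x₀) x₀
      linarith
    rw [norm_smul, Real.norm_of_nonneg (NN_nonneg m y)]
    have h1 := le_ww m _ (hf' (x - y))
    have h2 := ww_shift m x y
    have h3 := NN_nonneg m y
    have h4 := ww_nonneg m y
    calc NN m y * ‖fderiv ℝ f (x - y)‖ ≤ (1 + NN m y) * (C * ((1 + ‖x‖) ^ (m + 3) * ww m y)) := by
          gcongr
          · linarith
          · exact h1.trans (by gcongr)
      _ ≤ (1 + NN m y) * (C * ((2 + ‖x₀‖) ^ (m + 3) * ww m y)) := by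
          gcongr ?_ * (_ * (?_ ^ _ * _))
          linarith
      _ = _ := by ring
  have hmeas : AEStronglyMeasurable (fun y => NN m y • fderiv ℝ f (x₀ - y)) volume := by
    have : Continuous fun y => fderiv ℝ f (x₀ - y) := hcont.comp (by fun_prop)
    exact hN.aestronglyMeasurable.smul this.aestronglyMeasurable
  have hbi := (Nw_int m).const_mul (C * (2 + ‖x₀‖) ^ (m + 3))
  have hI : ∀ x, Integrable (fun y => f (x - y) * NN m y) := fun x =>
    conv_int m f (NN m) 1 hN (fun y => by
      rw [abs_of_nonneg (NN_nonneg m y)]; linarith) x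
  refine ⟨?_, hbi.mono' hmeas (Filter.Eventually.of_forall fun y =>
    hbd y x₀ (Metric.mem_ball_self one_pos))⟩
  refine hasFDerivAt_integral_of_dominated_of_fderiv_le (F := fun x y => f (x - y) * NN m y)
    (F' := fun x y => NN m y • fderiv ℝ f (x - y))
    (Metric.ball_mem_nhds x₀ one_pos)
    (Filter.Eventually.of_forall fun x => (hI x).1) (hI x₀) hmeas
    (Filter.Eventually.of_forall hbd) hbi (Filter.Eventually.of_forall fun y x _ => ?_)
  have h1 : HasFDerivAt f (fderiv ℝ f (x - y)) (x - y) := f.differentiableAt.hasFDerivAt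
  have h2 : HasFDerivAt (fun x => f (x - y)) (fderiv ℝ f (x - y)) x := by
    have h3 := h1.comp x ((hasFDerivAt_id x).sub_const y)
    rw [ContinuousLinearMap.comp_id] at h3
    exact h3
  exact h2.mul_const (NN m y)

/-- Powers of the smooth bracket. -/
def pw (m : ℕ) (a : ℝ) (x : EE m) : ℝ := (1 + ‖x‖ ^ 2) ^ a

lemma pp_pos (m : ℕ) (x : EE m) : 0 < 1 + ‖x‖ ^ 2 := by positivity

lemma pw_deriv (m : ℕ) (a : ℝ) (x : EE m) :
    HasFDerivAt (pw m a) ((2 * a * pw m (a - 1) x) • innerSL ℝ x) x := by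
  have h1 : HasFDerivAt (fun x : EE m => 1 + ‖x‖ ^ 2) (2 • innerSL ℝ x) x :=
    ((hasStrictFDerivAt_norm_sq x).hasFDerivAt).const_add 1
  have h2 := h1.rpow_const (p := a) (Or.inl (pp_pos m x).ne')
  refine h2.congr_fderiv ?_
  ext v
  simp [pw]
  ring

/-- First derivative of the smooth kernel. -/
def h1 (m : ℕ) (a : ℝ) (v x : EE m) : ℝ := 2 * a * pw m (a - 1) x * ⟪x, v⟫

/-- Second derivative of the smooth kernel. -/
def h2 (m : ℕ) (a : ℝ) (v w x : EE m) : ℝ :=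
  2 * a * (2 * (a - 1) * pw m (a - 2) x * ⟪x, w⟫ * ⟪x, v⟫ + pw m (a - 1) x * ⟪w, v⟫)

lemma pw_fderiv (m : ℕ) (a : ℝ) (v x : EE m) : fderiv ℝ (pw m a) x v = h1 m a v x := by
  rw [(pw_deriv m a x).fderiv]
  simp [h1]

lemma pw_cont (m : ℕ) (a : ℝ) : Continuous (pw m a) := by
  rw [continuous_iff_continuousAt]
  exact fun x => (pw_deriv m a x).continuousAt

lemma h1_deriv (m : ℕ) (a : ℝ) (v x : EE m) : ∃ L : EE m →L[ℝ] ℝ, HasFDerivAt (h1 m a v) L x ∧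
    ∀ w, L w = h2 m a v w x := by
  have e1 := (pw_deriv m (a - 1) x).const_mul (2 * a)
  have e2 : HasFDerivAt (fun y : EE m => ⟪y, v⟫) (innerSL ℝ v) x := by
    have := (innerSL ℝ v).hasFDerivAt (x := x)
    refine this.congr_of_eventuallyEq (Filter.Eventually.of_forall fun y => ?_)
    simp [real_inner_comm]
  refine ⟨_, e1.mul e2, fun w => ?_⟩
  have : a - 1 - 1 = a - 2 := by ring
  simp [h2, this, real_inner_comm]
  ring

lemma h1_cont (m : ℕ) (a : ℝ) (v : EE m) : Continuous (h1 m a v) := by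
  have := pw_cont m (a - 1)
  unfold h1
  fun_prop

lemma h2_cont (m : ℕ) (a : ℝ) (v w : EE m) : Continuous (h2 m a v w) := by
  have := pw_cont m (a - 1)
  have := pw_cont m (a - 2)
  unfold h2
  fun_prop

lemma pw_nonneg (m : ℕ) (a : ℝ) (x : EE m) : 0 ≤ pw m a x := by unfold pw; positivity

lemma pw_le_one (m : ℕ) (a : ℝ) (ha : a ≤ 0) (x : EE m) : pw m a x ≤ 1 := by
  unfold pw
  exact Real.rpow_le_one_of_one_le_of_nonpos (by nlinarith [norm_nonneg x]) ha

lemma pw_succ (m : ℕ) (a : ℝ) (x : EE m) : pw m (a - 1) x * (1 + ‖x‖ ^ 2) = pw m a x := by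
  unfold pw
  rw [Real.rpow_sub_one (pp_pos m x).ne']
  field_simp

lemma h1_bound (m : ℕ) (a : ℝ) (ha : a ≤ 0) (v x : EE m) : |h1 m a v x| ≤ 2 * |a| * ‖v‖ := by
  have e1 : |⟪x, v⟫| ≤ ‖x‖ * ‖v‖ := abs_real_inner_le_norm x v
  have e2 : ‖x‖ ≤ 1 + ‖x‖ ^ 2 := by nlinarith [sq_nonneg (‖x‖ - 1), norm_nonneg x]
  have e3 := pw_le_one m a ha x
  have e4 := pw_nonneg m (a - 1) x
  have e5 := pw_succ m a x
  unfold h1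
  rw [abs_mul, abs_mul, abs_mul, abs_two, abs_of_nonneg e4]
  calc 2 * |a| * pw m (a - 1) x * |⟪x, v⟫|
      ≤ 2 * |a| * pw m (a - 1) x * ((1 + ‖x‖ ^ 2) * ‖v‖) := by
        gcongr
        exact e1.trans (by gcongr)
    _ = 2 * |a| * (pw m (a - 1) x * (1 + ‖x‖ ^ 2)) * ‖v‖ := by ring
    _ ≤ 2 * |a| * 1 * ‖v‖ := by rw [e5]; gcongr
    _ = _ := by ring

lemma h2_bound (m : ℕ) (a : ℝ) (v w x : EE m) :
    |h2 m a v w x| ≤ 2 * |a| * (2 * |a - 1| + 1) * ‖v‖ * ‖w‖ * pw m (a - 1) x := by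
  have e1 : |⟪x, v⟫| ≤ ‖x‖ * ‖v‖ := abs_real_inner_le_norm x v
  have e1' : |⟪x, w⟫| ≤ ‖x‖ * ‖w‖ := abs_real_inner_le_norm x w
  have e1'' : |⟪w, v⟫| ≤ ‖w‖ * ‖v‖ := abs_real_inner_le_norm w v
  have e4 := pw_nonneg m (a - 1) x
  have e4' := pw_nonneg m (a - 2) x
  have e5 := pw_succ m (a - 1) x
  rw [show a - 1 - 1 = a - 2 by ring] at e5
  unfold h2
  rw [abs_mul, abs_mul, abs_two]
  have : |2 * (a - 1) * pw m (a - 2) x * ⟪x, w⟫ * ⟪x, v⟫ + pw m (a - 1) x * ⟪w, v⟫| ≤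
      (2 * |a - 1| + 1) * ‖v‖ * ‖w‖ * pw m (a - 1) x := by
    refine (abs_add_le _ _).trans ?_
    simp only [abs_mul, abs_two, abs_of_nonneg e4, abs_of_nonneg e4']
    calc _ ≤ 2 * |a - 1| * pw m (a - 2) x * (‖x‖ * ‖w‖) * (‖x‖ * ‖v‖)
          + pw m (a - 1) x * (‖w‖ * ‖v‖) := by gcongr
      _ = 2 * |a - 1| * (pw m (a - 2) x * ‖x‖ ^ 2) * ‖w‖ * ‖v‖
          + pw m (a - 1) x * (‖w‖ * ‖v‖) := by ring
      _ ≤ 2 * |a - 1| * (pw m (a - 1) x) * ‖w‖ * ‖v‖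
          + pw m (a - 1) x * (‖w‖ * ‖v‖) := by
          gcongr
          nlinarith
      _ = _ := by ring
  calc _ ≤ 2 * |a| * ((2 * |a - 1| + 1) * ‖v‖ * ‖w‖ * pw m (a - 1) x) := by gcongr
    _ = _ := by ring

lemma pw_decay (m : ℕ) (x : EE m) :
    pw m (-(m : ℝ) / 2 - 1) x * (1 + ‖x‖) ^ (m + 2) ≤ 2 ^ (((m : ℝ) + 2) / 2) := by
  have h := rpow_neg_one_add_norm_sq_le x (r := (m : ℝ) + 2) (by positivity)
  have e : (-(m : ℝ) / 2 - 1) = -((m : ℝ) + 2) / 2 := by ring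
  unfold pw
  rw [e]
  have hp : (0 : ℝ) < 1 + ‖x‖ := by positivity
  calc _ ≤ (2 ^ (((m : ℝ) + 2) / 2) * (1 + ‖x‖) ^ (-((m : ℝ) + 2))) * (1 + ‖x‖) ^ (m + 2) := by
        gcongr
    _ = _ := by
        rw [Real.rpow_neg hp.le, ← Real.rpow_natCast (1 + ‖x‖) (m + 2)]
        push_cast
        rw [mul_assoc, inv_mul_cancel₀ (by positivity), mul_one]

lemma bdd_int (m : ℕ) (f : 𝓢(EE m, ℝ)) (k : EE m → ℝ) (hk : Continuous k) (C : ℝ)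
    (hC : ∀ x, |k x| ≤ C) (x : EE m) : Integrable (fun z => k (x - z) * f z) := by
  refine f.integrable.bdd_mul (c := C) ?_ (Filter.Eventually.of_forall fun z => hC _)
  exact (hk.comp (by fun_prop)).aestronglyMeasurable

lemma refl_deriv (m : ℕ) (k : EE m → ℝ) (x z : EE m) (L : EE m →L[ℝ] ℝ)
    (h : HasFDerivAt k L (x - z)) : HasFDerivAt (fun z => k (x - z)) (-L) z := by
  have h3 := h.comp z ((hasFDerivAt_id z).const_sub x)
  refine h3.congr_fderiv ?_
  ext v
  simp

lemma ibp (m : ℕ) (f : 𝓢(EE m, ℝ)) (k : EE m → ℝ) (k' : EE m → ℝ) (v : EE m)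
    (hk : ∀ x, ∃ L : EE m →L[ℝ] ℝ, HasFDerivAt k L x ∧ L v = k' x) (hk' : Continuous k')
    (C C' : ℝ) (hC : ∀ x, |k x| ≤ C) (hC' : ∀ x, |k' x| ≤ C') (x : EE m) :
    ∫ z, k (x - z) * (∂_{v} f) z = ∫ z, k' (x - z) * f z := by
  have hkc : Continuous k := by
    rw [continuous_iff_continuousAt]
    intro x
    obtain ⟨L, hL, _⟩ := hk x
    exact hL.continuousAt
  have hd : ∀ z, DifferentiableAt ℝ (fun z => k (x - z)) z := by
    intro z
    obtain ⟨L, hL, _⟩ := hk (x - z)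
    exact (refl_deriv m k x z L hL).differentiableAt
  have hfd : ∀ z, fderiv ℝ (fun z => k (x - z)) z v = - k' (x - z) := by
    intro z
    obtain ⟨L, hL, e⟩ := hk (x - z)
    rw [(refl_deriv m k x z L hL).fderiv]
    simp [e]
  have i1 := bdd_int m f k' hk' C' hC' x
  have key := integral_mul_fderiv_eq_neg_fderiv_mul_of_integrable (μ := volume) (𝕜 := ℝ)
    (f := fun z => k (x - z)) (g := f) (v := v)
    (by simp only [hfd, neg_mul]; exact i1.neg)
    (bdd_int m (∂_{v} f) k hkc C hC x) (bdd_int m f k hkc C hC x)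
    (fun z _ => hd z) (fun z _ => f.differentiableAt)
  simp only [hfd, neg_mul, integral_neg, neg_neg] at key
  exact key

lemma ibp2 (m : ℕ) (f : 𝓢(EE m, ℝ)) (u v : EE m) (x : EE m) :
    ∫ y, (∂_{v} (∂_{u} f)) (x - y) * pw m (-(m : ℝ) / 2) y =
    ∫ y, f (x - y) * h2 m (-(m : ℝ) / 2) v u y := by
  set a := -(m : ℝ) / 2 with ha
  have ha0 : a ≤ 0 := by
    rw [ha]
    have : (0 : ℝ) ≤ m := Nat.cast_nonneg m
    linarith
  have r1 := integral_sub_left_eq_self (fun y => (∂_{v} (∂_{u} f)) (x - y) * pw m a y) volume x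
  have r2 := integral_sub_left_eq_self (fun y => f (x - y) * h2 m a v u y) volume x
  rw [← r1, ← r2]
  simp only [sub_sub_cancel]
  have c0 : ∀ x, |pw m a x| ≤ 1 := fun x => by
    rw [abs_of_nonneg (pw_nonneg m a x)]; exact pw_le_one m a ha0 x
  have c2 : ∀ x, |h2 m a v u x| ≤ 2 * |a| * (2 * |a - 1| + 1) * ‖v‖ * ‖u‖ := fun x => by
    refine (h2_bound m a v u x).trans ?_
    exact mul_le_of_le_one_right (by positivity) (pw_le_one m _ (by linarith) x)
  have s1 := ibp m (∂_{u} f) (pw m a) (h1 m a v) v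
    (fun x => ⟨_, pw_deriv m a x, by simp [h1]⟩) (h1_cont m a v) _ _ c0 (h1_bound m a ha0 v) x
  have s2 := ibp m f (h1 m a v) (h2 m a v u) u
    (fun x => by
      obtain ⟨L, hL, e⟩ := h1_deriv m a v x
      exact ⟨L, hL, e u⟩) (h2_cont m a v u) _ _ (h1_bound m a ha0 v) c2 x
  simp only [mul_comm] at s1 s2 ⊢
  rw [s1, s2]

lemma pw_eq (m : ℕ) (y : EE m) : pw m (-(m : ℝ) / 2) y = ((√(1 + ‖y‖ ^ 2)) ^ m)⁻¹ := by
  unfold pw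
  rw [neg_div, Real.rpow_neg (pp_pos m y).le, Real.sqrt_eq_rpow, ← Real.rpow_natCast _ m,
    ← Real.rpow_mul (pp_pos m y).le]
  congr 2
  ring

lemma diff_bound (m : ℕ) (hm : 1 ≤ m) (y : EE m) :
    |NN m y - pw m (-(m : ℝ) / 2) y| * (1 + ‖y‖) ^ (m + 2) ≤ (2 * m * 2 ^ m) * (1 + NN m y) := by
  have hm' : (1 : ℝ) ≤ m := by exact_mod_cast hm
  rw [pw_eq]
  unfold NN
  rcases eq_or_ne y 0 with rfl | hy
  · have : m ≠ 0 := by omega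
    simp [this]
    have : (1 : ℝ) ≤ 2 ^ m := one_le_pow₀ (by norm_num)
    nlinarith
  have hr : 0 < ‖y‖ := norm_pos_iff.2 hy
  set r := ‖y‖
  set q := √(1 + r ^ 2) with hq
  have hq2 : q ^ 2 = 1 + r ^ 2 := Real.sq_sqrt (by positivity)
  have hq0 : 0 < q := Real.sqrt_pos.2 (by positivity)
  have hrq : r ≤ q := by nlinarith
  have hle : (q ^ m)⁻¹ ≤ (r ^ m)⁻¹ := by gcongr
  rw [abs_of_nonneg (by linarith)]
  have b1 : 1 - m / q ^ 2 ≤ (r / q) ^ m := by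
    have t0 : r / q ≤ 1 := (div_le_one hq0).2 hrq
    have t1 : (r / q) ^ (2 * m) ≤ (r / q) ^ m :=
      pow_le_pow_of_le_one (by positivity) t0 (by omega)
    have t2 : (r / q) ^ 2 = 1 + -(1 / q ^ 2) := by
      rw [div_pow]
      field_simp
      linarith
    have t3 := one_add_mul_le_pow (a := -(1 / q ^ 2)) (by
      have : 1 / q ^ 2 ≤ 1 := by
        rw [div_le_one (by positivity)]; nlinarith
      linarith) m
    rw [pow_mul, t2] at t1
    calc _ = 1 + (m : ℝ) * -(1 / q ^ 2) := by ring
      _ ≤ _ := t3.trans t1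
  have b2 : (r ^ m)⁻¹ - (q ^ m)⁻¹ ≤ (r ^ m)⁻¹ * (m / q ^ 2) := by
    have : (q ^ m)⁻¹ = (r ^ m)⁻¹ * (r / q) ^ m := by
      rw [div_pow]; field_simp
    rw [this]
    have : 0 ≤ (r ^ m)⁻¹ := by positivity
    nlinarith
  have b3 : (1 + r) ^ 2 ≤ 2 * q ^ 2 := by nlinarith [sq_nonneg (r - 1)]
  have b4 : (r ^ m)⁻¹ * (1 + r) ^ m ≤ 2 ^ m * (1 + (r ^ m)⁻¹) := by
    rcases le_total r 1 with h | h
    · have : (1 + r) ^ m ≤ 2 ^ m := by gcongr; linarith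
      have h3 : 0 ≤ (r ^ m)⁻¹ := by positivity
      have h4 : (0 : ℝ) < 2 ^ m := by positivity
      nlinarith
    · have : (1 + r) ^ m ≤ (2 * r) ^ m := by gcongr; linarith
      rw [mul_pow] at this
      have h4 : (0 : ℝ) < 2 ^ m := by positivity
      have h5 : (0 : ℝ) < (r ^ m)⁻¹ := by positivity
      calc _ ≤ (r ^ m)⁻¹ * (2 ^ m * r ^ m) := by gcongr
        _ = 2 ^ m := by field_simp
        _ ≤ _ := by nlinarith
  calc _ ≤ (r ^ m)⁻¹ * (m / q ^ 2) * (1 + r) ^ (m + 2) := by gcongr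
    _ = (r ^ m)⁻¹ * (1 + r) ^ m * (m / q ^ 2) * (1 + r) ^ 2 := by ring
    _ ≤ (2 ^ m * (1 + (r ^ m)⁻¹)) * (m / q ^ 2) * (2 * q ^ 2) := by gcongr
    _ = _ := by field_simp

lemma main_bound (m : ℕ) (hm : 1 ≤ m) (f : 𝓢(EE m, ℝ)) (u v : EE m) :
    ∃ C, 0 ≤ C ∧ ∀ x, |∫ y, (∂_{v} (∂_{u} f)) (x - y) * NN m y| * (1 + ‖x‖) ^ (m + 2) ≤ C := by
  set a := -(m : ℝ) / 2 with ha
  obtain ⟨C1, hC1, B1⟩ := conv_bound m (∂_{v} (∂_{u} f)) (fun y => NN m y - pw m a y)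
    (2 * m * 2 ^ m) (by positivity) (diff_bound m hm)
  obtain ⟨C2, hC2, B2⟩ := conv_bound m f (h2 m a v u)
    (2 * |a| * (2 * |a - 1| + 1) * ‖v‖ * ‖u‖ * 2 ^ (((m : ℝ) + 2) / 2)) (by positivity) (by
      intro y
      have e1 := h2_bound m a v u y
      have e2 := pw_decay m y
      have e3 := NN_nonneg m y
      calc _ ≤ 2 * |a| * (2 * |a - 1| + 1) * ‖v‖ * ‖u‖ * pw m (a - 1) y * (1 + ‖y‖) ^ (m + 2) := by
            gcongr
        _ = 2 * |a| * (2 * |a - 1| + 1) * ‖v‖ * ‖u‖ * (pw m (a - 1) y * (1 + ‖y‖) ^ (m + 2)) := by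
            ring
        _ ≤ 2 * |a| * (2 * |a - 1| + 1) * ‖v‖ * ‖u‖ * 2 ^ (((m : ℝ) + 2) / 2) := by gcongr
        _ ≤ _ := le_mul_of_one_le_right (by positivity) (by linarith))
  refine ⟨C1 + C2, by positivity, fun x => ?_⟩
  have ha0 : a ≤ 0 := by
    rw [ha]
    have : (0 : ℝ) ≤ m := Nat.cast_nonneg m
    linarith
  have i1 : Integrable (fun y => (∂_{v} (∂_{u} f)) (x - y) * pw m a y) :=
    conv_int m _ _ 1 (pw_cont m a).measurable (fun y => by
      rw [abs_of_nonneg (pw_nonneg m a y)]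
      linarith [pw_le_one m a ha0 y, NN_nonneg m y]) x
  have i2 : Integrable (fun y => (∂_{v} (∂_{u} f)) (x - y) * NN m y) :=
    conv_int m _ _ 1 (NN_meas m) (fun y => by
      rw [abs_of_nonneg (NN_nonneg m y)]; linarith) x
  have e : ∫ y, (∂_{v} (∂_{u} f)) (x - y) * NN m y =
      (∫ y, (∂_{v} (∂_{u} f)) (x - y) * (NN m y - pw m a y)) + ∫ y, f (x - y) * h2 m a v u y := by
    rw [← ibp2 m f u v x]
    simp only [mul_sub]
    rw [integral_sub i2 i1]
    ring
  rw [e]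
  have := abs_add_le (∫ y, (∂_{v} (∂_{u} f)) (x - y) * (NN m y - pw m a y))
    (∫ y, f (x - y) * h2 m a v u y)
  have p : 0 < (1 + ‖x‖) ^ (m + 2) := by positivity
  have := B1 x
  have := B2 x
  nlinarith

lemma fund_eq (m : ℕ) : ∃ c : ℝ, ∀ y : EE m, fundSol (m + 2) y = c * NN m y := by
  refine ⟨-(Real.Gamma (((m + 2 : ℕ) : ℝ) / 2 - 1) / (4 * Real.pi ^ (((m + 2 : ℕ) : ℝ) / 2))),
    fun y => ?_⟩
  unfold fundSol NN
  congr 1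
  rw [← Real.rpow_natCast, ← Real.rpow_neg (norm_nonneg y)]
  congr 1
  push_cast
  ring

lemma canE_inner (d : ℕ) (i : Fin d) (z : EuclideanSpace ℝ (Fin d)) : ⟪canE d i, z⟫ = z i := by
  simp [canE, EuclideanSpace.inner_single_left]

lemma norm_le_sum (d : ℕ) (z : EuclideanSpace ℝ (Fin d)) : ‖z‖ ≤ ∑ i, |⟪canE d i, z⟫| := by
  have h := (EuclideanSpace.basisFun (Fin d) ℝ).sum_repr z
  calc ‖z‖ = ‖∑ i, z i • EuclideanSpace.basisFun (Fin d) ℝ i‖ := by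
        conv_lhs => rw [← h]
        simp
    _ ≤ ∑ i, ‖z i • EuclideanSpace.basisFun (Fin d) ℝ i‖ := norm_sum_le _ _
    _ = _ := by
        refine Finset.sum_congr rfl fun i _ => ?_
        rw [norm_smul, canE_inner]
        simp

lemma main (m : ℕ) (hm : 1 ≤ m)
    (F : EE m → EE m) (hF : ∀ j, IsSchwartz (fun x => ⟪canE (m + 2) j, F x⟫))
    (Φ : EE m → ℝ) (hΦ : ∀ x, Φ x = vdiv F x) (φ : EE m → ℝ)
    (hφ : ∀ x, φ x = ∫ y, Φ y * fundSol (m + 2) (x - y)) :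
    (∀ x, DifferentiableAt ℝ φ x) ∧
      (∃ C, 0 ≤ C ∧ ∀ x, ‖gradient φ x‖ * (1 + ‖x‖) ^ (m + 2) ≤ C) ∧
      (∃ C, 0 ≤ C ∧ ∀ x, ‖F x‖ * (1 + ‖x‖) ^ (m + 2) ≤ C) := by
  choose g hg using hF
  obtain ⟨c, hc⟩ := fund_eq m
  set e : Fin (m + 2) → EE m := canE (m + 2) with he
  let ψ : 𝓢(EE m, ℝ) := ∑ j, ∂_{e j} (g j)
  have hψ : ∀ x, Φ x = ψ x := by
    intro x
    rw [hΦ]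
    simp only [vdiv, ψ, SchwartzMap.sum_apply]
    refine Finset.sum_congr rfl fun j _ => ?_
    rw [SchwartzMap.lineDerivOp_apply_eq_fderiv]
    congr 2
    funext y
    exact hg j y
  have hφ' : φ = fun x => c * ∫ y, ψ (x - y) * NN m y := by
    funext x
    rw [hφ, ← integral_const_mul, ← integral_sub_left_eq_self _ volume x]
    refine integral_congr_ae (Filter.Eventually.of_forall fun y => ?_)
    simp only [hψ, hc, sub_sub_cancel]
    ring
  have hD : ∀ x, HasFDerivAt φ (c • ∫ y, NN m y • fderiv ℝ ψ (x - y)) x := by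
    intro x
    rw [hφ']
    exact (conv_deriv m ψ x).1.const_mul c
  have hcomp : ∀ x i, ⟪e i, gradient φ x⟫ =
      c * ∑ j, ∫ y, (∂_{e i} (∂_{e j} (g j))) (x - y) * NN m y := by
    intro x i
    rw [real_inner_comm, gradient, InnerProductSpace.toDual_symm_apply, (hD x).fderiv]
    rw [ContinuousLinearMap.smul_apply, ContinuousLinearMap.integral_apply (conv_deriv m ψ x).2,
      smul_eq_mul]
    congr 1
    rw [← integral_finset_sum]
    · refine integral_congr_ae (Filter.Eventually.of_forall fun y => ?_)
      simp only [ContinuousLinearMap.smul_apply, smul_eq_mul]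
      rw [← SchwartzMap.lineDerivOp_apply_eq_fderiv, ← Finset.sum_mul, mul_comm]
      congr 1
      rw [← SchwartzMap.sum_apply, ← LineDeriv.lineDerivOp_sum]
    · intro j _
      exact conv_int m _ _ 1 (NN_meas m) (fun y => by
        rw [abs_of_nonneg (NN_nonneg m y)]; linarith) x
  refine ⟨fun x => (hD x).differentiableAt, ?_, ?_⟩
  · choose C hC hB using fun i j => main_bound m hm (g j) (e j) (e i)
    refine ⟨∑ i, |c| * ∑ j, C i j, Finset.sum_nonneg fun i _ =>
      mul_nonneg (abs_nonneg _) (Finset.sum_nonneg fun j _ => hC i j), fun x => ?_⟩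
    calc _ ≤ (∑ i, |⟪e i, gradient φ x⟫|) * (1 + ‖x‖) ^ (m + 2) := by
          gcongr
          exact norm_le_sum _ _
      _ ≤ _ := by
          rw [Finset.sum_mul]
          refine Finset.sum_le_sum fun i _ => ?_
          rw [hcomp, abs_mul, mul_assoc]
          gcongr
          calc _ ≤ (∑ j, |∫ y, (∂_{e i} (∂_{e j} (g j))) (x - y) * NN m y|) * (1 + ‖x‖) ^ (m + 2) := by
                gcongr
                exact Finset.abs_sum_le_sum_abs _ _
            _ ≤ _ := by
                rw [Finset.sum_mul]
                exact Finset.sum_le_sum fun j _ => hB i j x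
  · choose C hC hB using fun j => schw m ℝ (g j) (m + 2)
    refine ⟨∑ j, C j, Finset.sum_nonneg fun j _ => hC j, fun x => ?_⟩
    calc _ ≤ (∑ i, |⟪e i, F x⟫|) * (1 + ‖x‖) ^ (m + 2) := by
          gcongr
          exact norm_le_sum _ _
      _ ≤ _ := by
          rw [Finset.sum_mul]
          refine Finset.sum_le_sum fun i _ => ?_
          have h1 := hB i x
          have h2 : ⟪e i, F x⟫ = g i x := hg i x
          rw [h2, mul_comm]
          exact h1

end Aux

/-- the potential `φ` is differentiable, `‖∇φ(x)‖ ≤ C (1+‖x‖)^{−d}`, and both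
the potential part `F^p = ∇φ` and the solenoidal part `F^s = F − ∇φ` decay like
`(1+‖x‖)^{−d}`. -/
theorem stmt2 (d : ℕ) (hd : 3 ≤ d)
    (F : EuclideanSpace ℝ (Fin d) → EuclideanSpace ℝ (Fin d))
    (hF : ∀ j : Fin d, IsSchwartz (fun x => ⟪canE d j, F x⟫))
    (Φ : EuclideanSpace ℝ (Fin d) → ℝ) (hΦ : ∀ x, Φ x = vdiv F x)
    (φ : EuclideanSpace ℝ (Fin d) → ℝ)
    (hφ : ∀ x, φ x = ∫ y, Φ y * fundSol d (x - y)) :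
    (∀ x, DifferentiableAt ℝ φ x) ∧
      (∃ C, 0 ≤ C ∧ ∀ x, ‖gradient φ x‖ ≤ C * (1 + ‖x‖) ^ (-(d : ℝ))) ∧
      (∃ C', 0 ≤ C' ∧ ∀ x, ‖F x - gradient φ x‖ ≤ C' * (1 + ‖x‖) ^ (-(d : ℝ))) := by
  obtain ⟨m, rfl⟩ : ∃ m, d = m + 2 := ⟨d - 2, by omega⟩
  obtain ⟨h1, ⟨C, hC, hB⟩, ⟨C', hC', hB'⟩⟩ := Aux.main m (by omega) F hF Φ hΦ φ hφ
  have conv : ∀ (x : EuclideanSpace ℝ (Fin (m + 2))) (t K : ℝ), t * (1 + ‖x‖) ^ (m + 2) ≤ K →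
      t ≤ K * (1 + ‖x‖) ^ (-((m + 2 : ℕ) : ℝ)) := by
    intro x t K h
    rw [Real.rpow_neg (by positivity), Real.rpow_natCast, ← div_eq_mul_inv,
      le_div_iff₀ (by positivity)]
    exact h
  refine ⟨h1, ⟨C, hC, fun x => conv _ _ _ (hB x)⟩, C' + C, by positivity, fun x => conv _ _ _ ?_⟩
  have := norm_sub_le (F x) (gradient φ x)
  have p : 0 < (1 + ‖x‖) ^ (m + 2) := by positivity
  nlinarith [hB x, hB' x]
end
end

section
/- Let d ≥ 3 and let F : EuclideanSpace ℝ (Fin d) → EuclideanSpace ℝ (Fin d) be a vector field each of whose components x ↦ ⟪e_j, F(x)⟫ is a Schwartz function. Let Φ = div F and φ(x) = ∫_{ℝ^d} Φ(y)·G(x−y) dy, where G(x) = −(Γ(d/2−1)/(4π^{d/2}))·‖x‖^{2−d}. Then φ is three times continuously differentiable, and for every multi-index α with |α| = 2 or |α| = 3 there exists a constant C_α ≥ 0 such that |∂^α φ(x)| ≤ C_α·(1+‖x‖)^{1−d−|α|} for all x. In particular, the first partial derivatives of F^p = ∇φ are O((1+‖x‖)^{−d−1}) and its second partial derivatives are O((1+‖x‖)^{−d−2}).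 -/
open MeasureTheory Real
open scoped RealInnerProductSpace

noncomputable section

open scoped SchwartzMap LineDeriv ContDiff Topology

section Aux

variable {d : ℕ}

local notation "EE" => EuclideanSpace ℝ (Fin d)

lemma aux_peetre (x y : EE) {s : ℝ} (hs : 0 ≤ s) :
    (1 + ‖x - y‖) ^ (-s) ≤ (1 + ‖x‖) ^ (-s) * (1 + ‖y‖) ^ s := by
  have h1 : 0 < 1 + ‖x‖ := by positivity
  have h2 : 0 < 1 + ‖y‖ := by positivity
  have h3 : 0 < 1 + ‖x - y‖ := by positivity
  have h : 1 + ‖x‖ ≤ (1 + ‖x - y‖) * (1 + ‖y‖) := by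
    have : ‖x‖ ≤ ‖x - y‖ + ‖y‖ := by simpa using norm_add_le (x - y) y
    nlinarith [norm_nonneg (x - y), norm_nonneg y]
  have h' := Real.rpow_le_rpow h1.le h hs
  rw [Real.mul_rpow h3.le h2.le] at h'
  have p1 := Real.rpow_pos_of_pos h1 s
  have p3 := Real.rpow_pos_of_pos h3 s
  rw [Real.rpow_neg h1.le, Real.rpow_neg h3.le, inv_mul_eq_div, inv_le_comm₀ p3 (by positivity),
    inv_div, div_le_iff₀ (by positivity)]
  exact h'

lemma aux_schw {V : Type} [NormedAddCommGroup V] [NormedSpace ℝ V] (f : 𝓢(EE, V)) (s : ℝ) :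
    ∃ C, 0 ≤ C ∧ ∀ x, ‖f x‖ ≤ C * (1 + ‖x‖) ^ (-s) := by
  set k := ⌈s⌉₊
  refine ⟨2 ^ k * (Finset.Iic (k, 0)).sup (fun m => SchwartzMap.seminorm ℝ m.1 m.2) f,
    by positivity, fun x => ?_⟩
  have h := SchwartzMap.one_add_le_sup_seminorm_apply (𝕜 := ℝ) (m := (k, 0)) (k := k) (n := 0)
    le_rfl le_rfl f x
  rw [norm_iteratedFDeriv_zero] at h
  have h1 : 1 ≤ 1 + ‖x‖ := by simp
  have h0 : 0 < 1 + ‖x‖ := by positivity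
  have h2 : (1 + ‖x‖) ^ s ≤ (1 + ‖x‖) ^ k := by
    rw [← Real.rpow_natCast]
    exact Real.rpow_le_rpow_of_exponent_le h1 (Nat.le_ceil s)
  have p := Real.rpow_pos_of_pos h0 s
  rw [Real.rpow_neg h0.le, ← div_eq_mul_inv, le_div_iff₀ p, mul_comm]
  refine le_trans ?_ h
  gcongr

/-- weights of moderate growth -/
def Wt (g : EE → ℝ) : Prop :=
  AEStronglyMeasurable g volume ∧
    ∃ s : ℝ, 0 ≤ s ∧ Integrable (fun y => |g y| * (1 + ‖y‖) ^ (-s))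

lemma Wt.meas {g : EE → ℝ} (hg : Wt g) {V : Type} [NormedAddCommGroup V] [NormedSpace ℝ V]
    (f : 𝓢(EE, V)) (x : EE) : AEStronglyMeasurable (fun y => g y • f (x - y)) :=
  hg.1.smul (f.continuous.comp (by fun_prop)).aestronglyMeasurable

lemma Wt.integrable {g : EE → ℝ} (hg : Wt g) {V : Type} [NormedAddCommGroup V] [NormedSpace ℝ V]
    (f : 𝓢(EE, V)) (x : EE) : Integrable (fun y => g y • f (x - y)) := by
  obtain ⟨s, hs, hi⟩ := hg.2
  obtain ⟨C, hC, hb⟩ := aux_schw f s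
  refine (hi.mul_const (C * (1 + ‖x‖) ^ s)).mono' (hg.meas f x) (.of_forall fun y => ?_)
  have h := aux_peetre y x hs
  rw [norm_smul, Real.norm_eq_abs]
  have h2 := hb (x - y)
  rw [norm_sub_rev] at h2
  calc |g y| * ‖f (x - y)‖ ≤ |g y| * (C * ((1 + ‖y‖) ^ (-s) * (1 + ‖x‖) ^ s)) := by
        gcongr; exact h2.trans (by gcongr)
    _ = _ := by ring

lemma Wt.hasFDerivAt {g : EE → ℝ} (hg : Wt g) {V : Type} [NormedAddCommGroup V] [NormedSpace ℝ V]
    [CompleteSpace V] (f : 𝓢(EE, V)) (x : EE) :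
    HasFDerivAt (fun x => ∫ y, g y • f (x - y))
      (∫ y, g y • SchwartzMap.fderivCLM ℝ _ _ f (x - y)) x := by
  obtain ⟨s, hs, hi⟩ := hg.2
  obtain ⟨C, hC, hb⟩ := aux_schw (SchwartzMap.fderivCLM ℝ _ _ f) s
  refine hasFDerivAt_integral_of_dominated_of_fderiv_le
    (F := fun x y => g y • f (x - y))
    (F' := fun x y => g y • SchwartzMap.fderivCLM ℝ _ _ f (x - y))
    (bound := fun y => (|g y| * (1 + ‖y‖) ^ (-s)) * (C * (2 + ‖x‖) ^ s))
    (Metric.ball_mem_nhds x one_pos)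
    (.of_forall fun z => hg.meas f z) (hg.integrable f x) (hg.meas _ x)
    (.of_forall fun y z hz => ?_) (hi.mul_const _) (.of_forall fun y z hz => ?_)
  · have h := aux_peetre y z hs
    rw [norm_smul, Real.norm_eq_abs]
    have h2 := hb (z - y)
    rw [norm_sub_rev] at h2
    have h3 : 1 + ‖z‖ ≤ 2 + ‖x‖ := by
      rw [mem_ball_iff_norm] at hz
      have : ‖z‖ ≤ ‖z - x‖ + ‖x‖ := by simpa using norm_add_le (z - x) x
      linarith
    calc |g y| * ‖SchwartzMap.fderivCLM ℝ _ _ f (z - y)‖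
        ≤ |g y| * (C * ((1 + ‖y‖) ^ (-s) * (2 + ‖x‖) ^ s)) := by
          gcongr; exact h2.trans (by gcongr; exact h.trans (by gcongr))
      _ = _ := by ring
  · have h1 : HasFDerivAt (fun w => f (w - y)) (fderiv ℝ f (z - y)) z := by
      have := (f.differentiableAt (x := z - y)).hasFDerivAt.comp z
        ((hasFDerivAt_id z).sub_const y)
      simpa [Function.comp_def] using this
    exact h1.const_smul (g y)

lemma Wt.contDiff {g : EE → ℝ} (hg : Wt g) (n : ℕ) :
    ∀ {V : Type} [NormedAddCommGroup V] [NormedSpace ℝ V]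
    [CompleteSpace V] (f : 𝓢(EE, V)), ContDiff ℝ n (fun x => ∫ y, g y • f (x - y)) := by
  induction n with
  | zero =>
    intro V _ _ _ f
    simp only [Nat.cast_zero, contDiff_zero]
    exact continuous_iff_continuousAt.2 fun x => (hg.hasFDerivAt f x).continuousAt
  | succ n ih =>
    intro V _ _ _ f
    push_cast
    rw [contDiff_succ_iff_fderiv]
    refine ⟨fun x => (hg.hasFDerivAt f x).differentiableAt, by simp, ?_⟩
    have : fderiv ℝ (fun x => ∫ y, g y • f (x - y)) =
      fun x => ∫ y, g y • SchwartzMap.fderivCLM ℝ _ _ f (x - y) := by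
      ext1 x; exact (hg.hasFDerivAt f x).fderiv
    rw [this]
    exact ih _

lemma Wt.iteratedFDeriv {g : EE → ℝ} (hg : Wt g) (f : 𝓢(EE, ℝ)) (n : ℕ) :
    ∀ (m : Fin n → EE) (x : EE), iteratedFDeriv ℝ n (fun x => ∫ y, g y • f (x - y)) x m =
      ∫ y, g y • (∂^{m} f) (x - y) := by
  induction n with
  | zero => intro m x; simp
  | succ n ih =>
    intro m x
    rw [iteratedFDeriv_succ_apply_left, LineDeriv.iteratedLineDerivOp_succ_left]
    have hd : DifferentiableAt ℝ (_root_.iteratedFDeriv ℝ n (fun x => ∫ y, g y • f (x - y))) x :=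
      ((hg.contDiff (n + 1) f).differentiable_iteratedFDeriv (by exact_mod_cast Nat.lt_succ_self n)) x
    have h1 : (fderiv ℝ (_root_.iteratedFDeriv ℝ n (fun x => ∫ y, g y • f (x - y))) x) (m 0)
        (Fin.tail m) = fderiv ℝ (fun z => _root_.iteratedFDeriv ℝ n
          (fun x => ∫ y, g y • f (x - y)) z (Fin.tail m)) x (m 0) := by
      rw [fderiv_continuousMultilinear_apply_const_apply hd]
    rw [h1]
    simp_rw [ih]
    rw [(hg.hasFDerivAt (∂^{Fin.tail m} f) x).fderiv,
      ContinuousLinearMap.integral_apply (hg.integrable _ x)]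
    rfl

/-- Smooth functions which agree with a homogeneous function at infinity. -/
def HSymb (s : ℝ) (g : EE → ℝ) : Prop :=
  ContDiff ℝ ∞ g ∧ ∃ h : EE → ℝ, ContDiffOn ℝ ∞ h {0}ᶜ ∧
    (∀ t : ℝ, 0 < t → ∀ x : EE, x ≠ 0 → h (t • x) = t ^ s * h x) ∧ ∀ x, 2 < ‖x‖ → g x = h x

lemma HSymb.deriv {s : ℝ} {g : EE → ℝ} (hg : HSymb s g) (v : EE) :
    HSymb (s - 1) (fun x => fderiv ℝ g x v) := by
  obtain ⟨hg1, h, hc, hh, he⟩ := hg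
  have ho : IsOpen ({0}ᶜ : Set EE) := isOpen_compl_singleton
  refine ⟨?_, fun x => fderiv ℝ h x v, ?_, ?_, ?_⟩
  · exact (hg1.fderiv_right (m := ∞) (by simp)).clm_apply contDiff_const
  · exact (hc.fderiv_of_isOpen ho (m := ∞) (by simp)).clm_apply contDiffOn_const
  · intro t ht x hx
    have hdx : ∀ y : EE, y ≠ 0 → DifferentiableAt ℝ h y := fun y hy =>
      (hc.contDiffAt (ho.mem_nhds hy)).differentiableAt (by simp)
    have htx : t • x ≠ 0 := smul_ne_zero ht.ne' hx
    have e1 : HasFDerivAt (fun y => h (t • y)) ((fderiv ℝ h (t • x)).comp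
        (t • ContinuousLinearMap.id ℝ EE)) x :=
      (hdx _ htx).hasFDerivAt.comp x ((hasFDerivAt_id x).const_smul t)
    have e2 : HasFDerivAt (fun y => t ^ s * h y) (t ^ s • fderiv ℝ h x) x :=
      (hdx _ hx).hasFDerivAt.const_mul _
    have e3 : (fun y => h (t • y)) =ᶠ[𝓝 x] (fun y => t ^ s * h y) := by
      filter_upwards [ho.mem_nhds hx] with y hy using hh t ht y hy
    have e4 := (e2.congr_of_eventuallyEq e3).unique e1
    have e5 := congrArg (fun L => L v) e4
    simp only [ContinuousLinearMap.smul_apply, ContinuousLinearMap.comp_apply,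
      ContinuousLinearMap.id_apply, map_smul, smul_eq_mul] at e5
    rw [Real.rpow_sub_one ht.ne']
    field_simp
    linarith
  · intro x hx
    have : g =ᶠ[𝓝 x] h := by
      filter_upwards [(isOpen_lt continuous_const continuous_norm).mem_nhds hx] with y hy
        using he y hy
    simp only [this.fderiv_eq]

lemma HSymb.bound {s : ℝ} (hs : s ≤ 0) {g : EE → ℝ} (hg : HSymb s g) :
    ∃ C, 0 ≤ C ∧ ∀ x, |g x| ≤ C * (1 + ‖x‖) ^ s := by
  obtain ⟨hg1, h, hc, hh, he⟩ := hg
  obtain ⟨C1, h1⟩ := (isCompact_sphere (0 : EE) 1).exists_bound_of_continuousOn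
    (hc.continuousOn.mono (s := {0}ᶜ) (t := Metric.sphere 0 1) (by
      intro x hx; rintro rfl; simp at hx))
  obtain ⟨C2, h2⟩ := (isCompact_closedBall (0 : EE) 2).exists_bound_of_continuousOn
    hg1.continuous.continuousOn
  refine ⟨|C1| * 2 ^ (-s) + |C2| * 3 ^ (-s), by positivity, fun x => ?_⟩
  have hx0 : 0 < 1 + ‖x‖ := by positivity
  by_cases hx : 2 < ‖x‖
  · have hxn : 0 < ‖x‖ := by linarith
    have hx0' : x ≠ 0 := norm_pos_iff.1 hxn
    have e := hh ‖x‖ hxn (‖x‖⁻¹ • x) (smul_ne_zero (by positivity) hx0')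
    rw [smul_smul, mul_inv_cancel₀ hxn.ne', one_smul] at e
    have b := h1 (‖x‖⁻¹ • x) (by simp [norm_smul, hxn.ne'])
    rw [Real.norm_eq_abs] at b
    rw [he x hx, e, abs_mul, abs_of_nonneg (by positivity)]
    have q : ‖x‖ ^ s ≤ 2 ^ (-s) * (1 + ‖x‖) ^ s := by
      have := Real.rpow_le_rpow_of_nonpos hx0 (by linarith : 1 + ‖x‖ ≤ 2 * ‖x‖) hs
      rw [Real.mul_rpow (by norm_num) hxn.le] at this
      rw [Real.rpow_neg (by norm_num), inv_mul_eq_div, le_div_iff₀ (by positivity)]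
      linarith
    calc ‖x‖ ^ s * |h (‖x‖⁻¹ • x)| ≤ (2 ^ (-s) * (1 + ‖x‖) ^ s) * |C1| := by
          exact mul_le_mul q (b.trans (le_abs_self _)) (abs_nonneg _) (by positivity)
      _ = |C1| * 2 ^ (-s) * (1 + ‖x‖) ^ s := by ring
      _ ≤ _ := by
        gcongr
        have : 0 ≤ |C2| * 3 ^ (-s) := by positivity
        linarith
  · have b := h2 x (by simpa using hx)
    rw [Real.norm_eq_abs] at b
    have q : 1 ≤ 3 ^ (-s) * (1 + ‖x‖) ^ s := by
      have := Real.rpow_le_rpow_of_nonpos hx0 (by linarith : 1 + ‖x‖ ≤ 3) hs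
      rw [Real.rpow_neg (by norm_num), inv_mul_eq_div, le_div_iff₀ (by positivity)]
      linarith
    calc |g x| ≤ |C2| * 1 := by rw [mul_one]; exact b.trans (le_abs_self _)
      _ ≤ |C2| * (3 ^ (-s) * (1 + ‖x‖) ^ s) := by gcongr
      _ = |C2| * 3 ^ (-s) * (1 + ‖x‖) ^ s := by ring
      _ ≤ _ := by
        gcongr
        have : 0 ≤ |C1| * 2 ^ (-s) := by positivity
        linarith

lemma HSymb.wt {s : ℝ} (hs : s ≤ 0) {g : EE → ℝ} (hg : HSymb s g) : Wt g := by
  obtain ⟨C, hC, hb⟩ := hg.bound hs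
  have hgc := hg.1.continuous
  refine ⟨hgc.aestronglyMeasurable, d + 1, by positivity, ?_⟩
  have hi : Integrable (fun y : EE => (1 + ‖y‖) ^ (-((d : ℝ) + 1))) :=
    integrable_one_add_norm (by simp)
  refine (hi.const_mul C).mono' ?_ (.of_forall fun y => ?_)
  · exact hgc.abs.aestronglyMeasurable.mul hi.1
  · have : (1 + ‖y‖) ^ s ≤ 1 := Real.rpow_le_one_of_one_le_of_nonpos (by simp) hs
    rw [Real.norm_eq_abs, abs_of_nonneg (by positivity)]
    gcongr
    exact (hb y).trans (by nlinarith)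

lemma HSymb.ibp {s : ℝ} (hs : s ≤ 0) {g : EE → ℝ} (hg : HSymb s g) (v : EE) (f : 𝓢(EE, ℝ)) (x : EE) :
    ∫ y, g y • (∂_{v} f) (x - y) = ∫ y, fderiv ℝ g y v • f (x - y) := by
  have hfd : ∀ y : EE, HasFDerivAt (fun y => f (x - y)) (-(fderiv ℝ f (x - y))) y := by
    intro y
    have := (f.differentiableAt (x := x - y)).hasFDerivAt.comp y ((hasFDerivAt_id y).const_sub x)
    simpa [Function.comp_def] using this
  have e : ∀ y, fderiv ℝ (fun y => f (x - y)) y v = -(∂_{v} f) (x - y) := by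
    intro y
    rw [(hfd y).fderiv]; rfl
  have i1 := (hg.wt hs).integrable (∂_{v} f) x
  have i2 := ((hg.deriv v).wt (by linarith)).integrable f x
  have i3 := (hg.wt hs).integrable f x
  simp only [smul_eq_mul] at *
  have := integral_mul_fderiv_eq_neg_fderiv_mul_of_integrable (μ := volume) (f := g)
    (g := fun y => f (x - y)) (v := v) i2 (by simpa [e] using i1) i3
    (fun y _ => hg.1.differentiable (by simp) y) (fun y _ => (hfd y).differentiableAt)
  simp only [e, mul_neg, integral_neg] at this
  linarith

lemma HSymb.ibp_iter (n : ℕ) : ∀ {s : ℝ} (_ : s ≤ 0) {g : EE → ℝ} (_ : HSymb s g) (m : Fin n → EE),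
    ∃ g', HSymb (s - n) g' ∧ ∀ (f : 𝓢(EE, ℝ)) (x : EE),
    ∫ y, g y • (∂^{m} f) (x - y) = ∫ y, g' y • f (x - y) := by
  induction n with
  | zero => intro s hs g hg m; exact ⟨g, by simpa using hg, fun f x => by simp⟩
  | succ n ih =>
    intro s hs g hg m
    obtain ⟨g', h1, h2⟩ := ih (by linarith) (hg.deriv (m 0)) (Fin.tail m)
    refine ⟨g', ?_, fun f x => ?_⟩
    · convert h1 using 1; push_cast; ring
    · rw [LineDeriv.iteratedLineDerivOp_succ_left, hg.ibp hs, h2]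

lemma HSymb.decay {s : ℝ} (hs : s ≤ 0) {g : EE → ℝ} (hg : HSymb s g) (f : 𝓢(EE, ℝ)) :
    ∃ C, 0 ≤ C ∧ ∀ x, |∫ y, g y • f (x - y)| ≤ C * (1 + ‖x‖) ^ s := by
  obtain ⟨C, hC, hb⟩ := hg.bound hs
  obtain ⟨C', hC', hb'⟩ := aux_schw f (-s + (d + 1))
  have hi : Integrable (fun y : EE => (1 + ‖y‖) ^ (-((d : ℝ) + 1))) :=
    integrable_one_add_norm (by simp)
  refine ⟨C * C' * ∫ y : EE, (1 + ‖y‖) ^ (-((d : ℝ) + 1)), by positivity, fun x => ?_⟩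
  rw [← integral_sub_left_eq_self _ volume x]
  simp only [sub_sub_cancel]
  rw [← Real.norm_eq_abs, mul_right_comm, ← integral_const_mul]
  refine norm_integral_le_of_norm_le (hi.const_mul _) (.of_forall fun y => ?_)
  have hp := aux_peetre x y (neg_nonneg.2 hs)
  rw [neg_neg] at hp
  have hy : 0 < 1 + ‖y‖ := by positivity
  rw [norm_smul]
  calc ‖g (x - y)‖ * ‖f y‖ ≤ (C * ((1 + ‖x‖) ^ s * (1 + ‖y‖) ^ (-s))) *
        (C' * (1 + ‖y‖) ^ (-(-s + (d + 1)))) := by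
        gcongr
        · exact (hb _).trans (by gcongr)
        · exact hb' y
    _ = C * C' * (1 + ‖x‖) ^ s * ((1 + ‖y‖) ^ (-s) * (1 + ‖y‖) ^ (-(-s + (d + 1)))) := by ring
    _ = _ := by rw [← Real.rpow_add hy]; congr 2; ring

lemma aux_compact_decay {g : EE → ℝ} (hg : Integrable g) (hz : ∀ y, 2 < ‖y‖ → g y = 0)
    (f : 𝓢(EE, ℝ)) {s : ℝ} (hs : s ≤ 0) :
    ∃ C, 0 ≤ C ∧ ∀ x, |∫ y, g y • f (x - y)| ≤ C * (1 + ‖x‖) ^ s := by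
  obtain ⟨C, hC, hb⟩ := aux_schw f (-s)
  rw [neg_neg] at hb
  refine ⟨C * 3 ^ (-s) * ∫ y, ‖g y‖, by positivity, fun x => ?_⟩
  rw [← Real.norm_eq_abs, mul_right_comm, ← integral_const_mul]
  refine norm_integral_le_of_norm_le (hg.norm.const_mul _) (.of_forall fun y => ?_)
  rw [norm_smul]
  by_cases hy : 2 < ‖y‖
  · simp [hz y hy]
  · have hp := aux_peetre x y (neg_nonneg.2 hs)
    rw [neg_neg] at hp
    have : (1 + ‖y‖) ^ (-s) ≤ 3 ^ (-s) :=
      Real.rpow_le_rpow (by positivity) (by linarith) (by linarith)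
    calc ‖g y‖ * ‖f (x - y)‖ ≤ ‖g y‖ * (C * ((1 + ‖x‖) ^ s * 3 ^ (-s))) := by
          gcongr
          exact (hb _).trans (by gcongr; exact hp.trans (by gcongr))
      _ = _ := by ring

/-- the smooth cutoff -/
def cutoff (d : ℕ) : ContDiffBump (0 : EuclideanSpace ℝ (Fin d)) := ⟨1, 2, by norm_num, by norm_num⟩

lemma fundSol_contDiffAt (x : EE) (hx : x ≠ 0) : ContDiffAt ℝ ∞ (fundSol d) x := by
  unfold fundSol
  exact contDiffAt_const.mul ((contDiffAt_norm ℝ hx).rpow_const_of_ne (norm_ne_zero_iff.2 hx))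

lemma sym_far : HSymb ((2 : ℝ) - d) (fun x : EE => (1 - cutoff d x) * fundSol d x) := by
  refine ⟨?_, fundSol d, fun x hx => (fundSol_contDiffAt x hx).contDiffWithinAt, ?_, ?_⟩
  · rw [contDiff_iff_contDiffAt]
    intro x
    by_cases hx : x = 0
    · subst hx
      have : (fun x : EE => (1 - cutoff d x) * fundSol d x) =ᶠ[𝓝 0] fun _ => 0 := by
        filter_upwards [(cutoff d).eventuallyEq_one] with y hy
        simp [hy]
      exact contDiffAt_const.congr_of_eventuallyEq this
    · exact (contDiffAt_const.sub (cutoff d).contDiffAt).mul (fundSol_contDiffAt x hx)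
  · intro t ht x hx
    simp only [fundSol, norm_smul, Real.norm_eq_abs, abs_of_pos ht]
    rw [Real.mul_rpow ht.le (norm_nonneg _)]
    ring
  · intro x hx
    have : cutoff d x = 0 := (cutoff d).zero_of_le_dist (by simpa [cutoff] using hx.le)
    simp [this]

lemma fundSol_meas : Measurable (fundSol d) := by
  unfold fundSol
  exact (measurable_norm.pow_const _).const_mul _

lemma integrable_near (hd : 3 ≤ d) : Integrable (fun x : EE => cutoff d x * fundSol d x) := by
  have : Nonempty (Fin d) := ⟨⟨0, by omega⟩⟩
  have h1 : IntegrableOn (fun x : EE => ‖x‖ ^ ((2 : ℝ) - d)) (Metric.ball 0 2) := by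
    rw [integrableOn_fun_norm_addHaar volume (f := fun r : ℝ => r ^ ((2 : ℝ) - d))]
    have h2 : IntegrableOn (fun y : ℝ => y) (Set.Ioo 0 2) :=
      (continuous_id.integrableOn_Icc (a := 0) (b := 2)).mono_set Set.Ioo_subset_Icc_self
    refine h2.congr_fun (fun y hy => ?_) measurableSet_Ioo
    simp only [finrank_euclideanSpace, Fintype.card_fin, smul_eq_mul]
    rw [← Real.rpow_natCast, ← Real.rpow_add hy.1, Nat.cast_sub (by omega)]
    ring_nf
    simp
  have h2 : IntegrableOn (fundSol d) (Metric.ball 0 2) := h1.const_mul _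
  have h3 : Integrable ((Metric.ball (0 : EE) 2).indicator (fundSol d)) :=
    h2.integrable_indicator measurableSet_ball
  refine h3.mono ((cutoff d).continuous.aestronglyMeasurable.mul
    fundSol_meas.aestronglyMeasurable) (.of_forall fun x => ?_)
  by_cases hx : x ∈ Metric.ball (0 : EE) 2
  · rw [Set.indicator_of_mem hx, norm_mul]
    have a := (cutoff d).nonneg (x := x)
    have b := (cutoff d).le_one (x := x)
    rw [Real.norm_of_nonneg a]
    exact mul_le_of_le_one_left (norm_nonneg _) b
  · have : cutoff d x = 0 := (cutoff d).zero_of_le_dist (by simpa [cutoff] using hx)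
    simp [this]

lemma wt_fundSol (hd : 3 ≤ d) : Wt (fundSol d) := by
  have hd' : (3 : ℝ) ≤ d := by exact_mod_cast hd
  obtain ⟨s, hs, hi⟩ := ((sym_far (d := d)).wt (by linarith)).2
  refine ⟨fundSol_meas.aestronglyMeasurable, s, hs, ?_⟩
  refine (hi.add (integrable_near hd).norm).mono' ?_ (.of_forall fun y => ?_)
  · exact (fundSol_meas.abs.mul ((measurable_norm.const_add 1).pow_const _)).aestronglyMeasurable
  · have h1 : (1 + ‖y‖) ^ (-s) ≤ 1 :=
      Real.rpow_le_one_of_one_le_of_nonpos (by simp) (by linarith)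
    have h0 : 0 ≤ (1 + ‖y‖) ^ (-s) := by positivity
    rw [Real.norm_of_nonneg (by positivity)]
    simp only [Pi.add_apply, Real.norm_eq_abs]
    have h2 : |fundSol d y| ≤ |(1 - cutoff d y) * fundSol d y| + |cutoff d y * fundSol d y| := by
      refine le_trans (le_of_eq ?_) (abs_add_le _ _)
      congr 1; ring
    have h3 := abs_nonneg (cutoff d y * fundSol d y)
    nlinarith

lemma fundSol_decay (hd : 3 ≤ d) (n : ℕ) (m : Fin n → EE) (v : EE) (f : 𝓢(EE, ℝ)) :
    ∃ C, 0 ≤ C ∧ ∀ x, |∫ y, fundSol d y • (∂^{m} (∂_{v} f)) (x - y)| ≤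
      C * (1 + ‖x‖) ^ ((1 : ℝ) - d - n) := by
  have hd' : (3 : ℝ) ≤ d := by exact_mod_cast hd
  have hn : (0 : ℝ) ≤ n := by positivity
  obtain ⟨g', hg', he⟩ := HSymb.ibp_iter n (by linarith) (sym_far (d := d)) m
  obtain ⟨C1, hC1, h1⟩ := (hg'.deriv v).decay (by linarith) f
  obtain ⟨C2, hC2, h2⟩ := aux_compact_decay (integrable_near hd) (fun y hy => by
      have : cutoff d y = 0 := (cutoff d).zero_of_le_dist (by simpa [cutoff] using hy.le)
      simp [this]) (∂^{m} (∂_{v} f)) (s := (1 : ℝ) - d - n) (by linarith)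
  refine ⟨C1 + C2, by positivity, fun x => ?_⟩
  have e1 : ∫ y, fundSol d y • (∂^{m} (∂_{v} f)) (x - y) =
      (∫ y, ((1 - cutoff d y) * fundSol d y) • (∂^{m} (∂_{v} f)) (x - y)) +
      ∫ y, (cutoff d y * fundSol d y) • (∂^{m} (∂_{v} f)) (x - y) := by
    have i1 := ((sym_far (d := d)).wt (by linarith)).integrable (∂^{m} (∂_{v} f)) x
    have i0 : Wt (fun y : EE => cutoff d y * fundSol d y) :=
      ⟨(integrable_near hd).1, 0, le_rfl, by simpa using (integrable_near hd).abs⟩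
    rw [← integral_add i1 (i0.integrable _ x)]
    congr 1; ext y; simp only [smul_eq_mul]; ring
  rw [e1, he, hg'.ibp (by linarith), add_mul]
  refine (abs_add_le _ _).trans (add_le_add ?_ (h2 x))
  have h := h1 x
  rwa [show (2 : ℝ) - d - n - 1 = 1 - d - n by ring] at h

end Aux

/-- the potential `φ` is three times continuously differentiable and its mixed
partial derivatives of orders 2 and 3 decay like `(1+‖x‖)^{1−d−|α|}`. -/
theorem stmt3 (d : ℕ) (hd : 3 ≤ d)
    (F : EuclideanSpace ℝ (Fin d) → EuclideanSpace ℝ (Fin d))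
    (hF : ∀ j : Fin d, IsSchwartz (fun x => ⟪canE d j, F x⟫))
    (Φ : EuclideanSpace ℝ (Fin d) → ℝ) (hΦ : ∀ x, Φ x = vdiv F x)
    (φ : EuclideanSpace ℝ (Fin d) → ℝ)
    (hφ : ∀ x, φ x = ∫ y, Φ y * fundSol d (x - y)) :
    ContDiff ℝ 3 φ ∧
      ∀ n : ℕ, (n = 2 ∨ n = 3) → ∀ m : Fin n → Fin d,
        ∃ C, 0 ≤ C ∧ ∀ x,
          |iteratedFDeriv ℝ n φ x (fun i => canE d (m i))| ≤
            C * (1 + ‖x‖) ^ ((1 : ℝ) - d - n) := by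
  choose f hf using hF
  set S : 𝓢(EuclideanSpace ℝ (Fin d), ℝ) := ∑ j, ∂_{canE d j} (f j) with hS
  have hΦS : ∀ x, Φ x = S x := by
    intro x
    rw [hΦ, vdiv, hS, SchwartzMap.sum_apply]
    refine Finset.sum_congr rfl fun j _ => ?_
    rw [SchwartzMap.lineDerivOp_apply_eq_fderiv, funext (hf j)]
  have hφS : φ = fun x => ∫ y, fundSol d y • S (x - y) := by
    ext x
    rw [hφ, ← integral_sub_left_eq_self _ volume x]
    simp only [sub_sub_cancel, hΦS, smul_eq_mul, mul_comm]
  have hw := wt_fundSol hd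
  refine ⟨?_, ?_⟩
  · rw [hφS]; exact_mod_cast hw.contDiff 3 S
  · intro n _ m
    choose C hC hb using fun j => fundSol_decay hd n (fun i => canE d (m i)) (canE d j) (f j)
    refine ⟨∑ j, C j, Finset.sum_nonneg fun j _ => hC j, fun x => ?_⟩
    rw [hφS, hw.iteratedFDeriv S n, hS, LineDeriv.iteratedLineDerivOp_sum]
    simp only [SchwartzMap.sum_apply, Finset.smul_sum]
    rw [integral_finset_sum _ (fun j _ => hw.integrable _ x), Finset.sum_mul]
    exact (Finset.abs_sum_le_sum_abs _ _).trans (Finset.sum_le_sum fun j _ => hb j x)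
end
end

section
/- Let d ≥ 2 and let f : EuclideanSpace ℝ (Fin d) → ℝ be continuous with |f(x)| ≤ C·(1+‖x‖)^{-d} for all x and some constant C ≥ 0. Then for every unit vector ω and every p ∈ ℝ, the function y ↦ f(p•ω + y) is integrable on the orthogonal complement (ℝ∙ω)ᗮ with respect to its canonical volume; that is, the Radon transform [Rf](ω,p) = ∫_{y ∈ (ℝ∙ω)ᗮ} f(p•ω+y) dy is well defined for every (ω,p). -/
open MeasureTheory Real
open scoped RealInnerProductSpace

noncomputable section

/-- a continuous function bounded by `C (1+‖x‖)^{−d}` is integrable over every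
hyperplane, i.e. its Radon transform is well defined. -/
theorem stmt4 (d : ℕ) (hd : 2 ≤ d)
    (f : EuclideanSpace ℝ (Fin d) → ℝ) (hcont : Continuous f)
    (C : ℝ) (hC : 0 ≤ C)
    (hfb : ∀ x, |f x| ≤ C * (1 + ‖x‖) ^ (-(d : ℝ))) :
    ∀ ω : EuclideanSpace ℝ (Fin d), ‖ω‖ = 1 → ∀ p : ℝ,
      Integrable
        (fun y : ((ℝ ∙ ω)ᗮ : Submodule ℝ (EuclideanSpace ℝ (Fin d))) =>
          f (p • ω + (y : EuclideanSpace ℝ (Fin d)))) volume := by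
  intro ω hω p
  have hω0 : ω ≠ 0 := by
    intro h
    simp [h] at hω
  have hfin : (Module.finrank ℝ
      ((ℝ ∙ ω)ᗮ : Submodule ℝ (EuclideanSpace ℝ (Fin d))) : ℝ) < (d : ℝ) := by
    have h1 := Submodule.finrank_add_finrank_orthogonal (ℝ ∙ ω)
    rw [finrank_span_singleton hω0, finrank_euclideanSpace_fin] at h1
    exact_mod_cast (by omega)
  have hint := (integrable_one_add_norm (μ := (volume : Measure
      ((ℝ ∙ ω)ᗮ : Submodule ℝ (EuclideanSpace ℝ (Fin d))))) hfin).const_mul C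
  refine hint.mono' (Continuous.aestronglyMeasurable (by fun_prop))
    (Filter.Eventually.of_forall fun y => ?_)
  rw [Real.norm_eq_abs]
  refine (hfb _).trans (mul_le_mul_of_nonneg_left ?_ hC)
  have horth : ⟪p • ω, (y : EuclideanSpace ℝ (Fin d))⟫ = 0 := by
    rw [real_inner_smul_left, Submodule.mem_orthogonal_singleton_iff_inner_right.mp y.2, mul_zero]
  have hn : ‖y‖ ≤ ‖p • ω + (y : EuclideanSpace ℝ (Fin d))‖ := by
    rw [← Submodule.norm_coe]
    have h2 := norm_add_sq_real (p • ω) (y : EuclideanSpace ℝ (Fin d))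
    rw [horth] at h2
    refine (sq_le_sq₀ (norm_nonneg _) (norm_nonneg _)).mp ?_
    nlinarith [sq_nonneg ‖p • ω‖]
  exact Real.rpow_le_rpow_of_nonpos (by positivity) (by linarith) (by simp)
end
end

section
/- Let d ≥ 2 and let F : EuclideanSpace ℝ (Fin d) → EuclideanSpace ℝ (Fin d) be a continuously differentiable solenoidal vector field (div F(x) = 0 for all x) satisfying ‖F(x)‖ ≤ C·(1+‖x‖)^{-d} for all x and some constant C ≥ 0. Then the transversal Radon transform of F vanishes identically: for every unit vector ω and every p ∈ ℝ, ∫_{y ∈ (ℝ∙ω)ᗮ} ⟪ω, F(p•ω+y)⟫ dy = 0. -/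
open MeasureTheory Real
open scoped RealInnerProductSpace

noncomputable section

/-- Smooth cutoffs with gradients going to zero uniformly. -/
lemma exists_cutoffs (H : Type) [NormedAddCommGroup H] [InnerProductSpace ℝ H]
    [FiniteDimensional ℝ H] :
    ∃ (χ : ℕ → H → ℝ) (K : ℝ), 0 ≤ K ∧ (∀ n, ContDiff ℝ 1 (χ n)) ∧
      (∀ n, HasCompactSupport (χ n)) ∧ (∀ n y, ‖χ n y‖ ≤ 1) ∧
      (∀ y, Filter.Tendsto (fun n => χ n y) Filter.atTop (nhds 1)) ∧
      (∀ n y, ‖fderiv ℝ (χ n) y‖ ≤ K / ((n : ℝ) + 1)) := by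
  let f : ContDiffBump (0 : H) := ⟨1, 2, one_pos, by norm_num⟩
  have hf : ContDiff ℝ 1 (f : H → ℝ) := f.contDiff (n := 1)
  have hpos : ∀ n : ℕ, (0 : ℝ) < (n : ℝ) + 1 := fun n => by positivity
  obtain ⟨K, hK⟩ := (f.hasCompactSupport.fderiv ℝ).exists_bound_of_continuous
    (hf.continuous_fderiv one_ne_zero)
  refine ⟨fun n y => f (((n : ℝ) + 1)⁻¹ • y), K, (norm_nonneg _).trans (hK 0), ?_, ?_, ?_, ?_, ?_⟩
  · intro n
    exact hf.comp (contDiff_const_smul _)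
  · intro n
    exact f.hasCompactSupport.comp_smul (inv_ne_zero (hpos n).ne')
  · intro n y
    rw [Real.norm_of_nonneg f.nonneg]
    exact f.le_one
  · intro y
    refine tendsto_const_nhds.congr' ?_
    obtain ⟨N, hN⟩ := exists_nat_gt ‖y‖
    filter_upwards [Filter.eventually_ge_atTop N] with n hn
    refine (f.one_of_mem_closedBall ?_).symm
    have h1 : (N : ℝ) ≤ n := by exact_mod_cast hn
    change _ ∈ Metric.closedBall (0 : H) 1
    rw [mem_closedBall_zero_iff, norm_smul, norm_inv, Real.norm_of_nonneg (hpos n).le,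
      inv_mul_le_iff₀ (hpos n)]
    linarith
  · intro n y
    rw [fderiv_comp_smul, norm_smul, norm_inv, Real.norm_of_nonneg (hpos n).le, div_eq_inv_mul]
    exact mul_le_mul_of_nonneg_left (hK _) (inv_nonneg.2 (hpos n).le)

/-- The divergence is the trace of the derivative, in any orthonormal basis. -/
lemma vdiv_eq_sum {d : ℕ} {F : EuclideanSpace ℝ (Fin d) → EuclideanSpace ℝ (Fin d)}
    (hreg : ContDiff ℝ 1 F) (b : OrthonormalBasis (Fin d) ℝ (EuclideanSpace ℝ (Fin d)))
    (x : EuclideanSpace ℝ (Fin d)) :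
    vdiv F x = ∑ j, ⟪b j, fderiv ℝ F x (b j)⟫ := by
  have h1 := LinearMap.trace_eq_sum_inner (𝕜 := ℝ) (fderiv ℝ F x).toLinearMap b
  have h2 := LinearMap.trace_eq_sum_inner (𝕜 := ℝ) (fderiv ℝ F x).toLinearMap
    (EuclideanSpace.basisFun (Fin d) ℝ)
  have h3 : vdiv F x = ∑ j, ⟪canE d j, fderiv ℝ F x (canE d j)⟫ := by
    unfold vdiv
    refine Finset.sum_congr rfl fun j _ => ?_
    have hF : DifferentiableAt ℝ F x := hreg.differentiable one_ne_zero x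
    have := ((innerSL ℝ (canE d j)).hasFDerivAt.comp x hF.hasFDerivAt).fderiv
    have e : (fun y => ⟪canE d j, F y⟫) = (innerSL ℝ (canE d j)) ∘ F := rfl
    rw [e, this]
    simp
  rw [h3]
  simp only [canE]
  simp only [EuclideanSpace.basisFun_apply, ContinuousLinearMap.coe_coe] at h1 h2
  rw [← h2, h1]

/-- Derivative of the truncated flux. -/
lemma hasDerivAt_flux {d : ℕ} {F : EuclideanSpace ℝ (Fin d) → EuclideanSpace ℝ (Fin d)}
    (hreg : ContDiff ℝ 1 F) (ω : EuclideanSpace ℝ (Fin d))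
    {χ : ((ℝ ∙ ω)ᗮ : Submodule ℝ (EuclideanSpace ℝ (Fin d))) → ℝ}
    (hχ : ContDiff ℝ 1 χ) (hs : HasCompactSupport χ) (p : ℝ) :
    HasDerivAt (fun q : ℝ => ∫ y : ((ℝ ∙ ω)ᗮ : Submodule ℝ (EuclideanSpace ℝ (Fin d))),
        χ y * ⟪ω, F (q • ω + (y : EuclideanSpace ℝ (Fin d)))⟫)
      (∫ y : ((ℝ ∙ ω)ᗮ : Submodule ℝ (EuclideanSpace ℝ (Fin d))),
        χ y * ⟪ω, fderiv ℝ F (p • ω + (y : EuclideanSpace ℝ (Fin d))) ω⟫) p := by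
  have hFc := hreg.continuous
  have hDc : Continuous (fderiv ℝ F) := hreg.continuous_fderiv one_ne_zero
  have hχc := hχ.continuous
  have hcomp : IsCompact ((Metric.closedBall p 1) ×ˢ (tsupport χ)) :=
    (isCompact_closedBall p 1).prod hs
  obtain ⟨M, hM⟩ := hcomp.exists_bound_of_continuousOn (f := fun z : ℝ × _ =>
    ⟪ω, fderiv ℝ F (z.1 • ω + (z.2 : EuclideanSpace ℝ (Fin d))) ω⟫)
    (Continuous.continuousOn (by fun_prop))
  refine (hasDerivAt_integral_of_dominated_loc_of_deriv_le (𝕜 := ℝ)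
    (s := Metric.closedBall p 1)
    (bound := fun y => ‖χ y‖ * M)
    (F' := fun q y => χ y * ⟪ω, fderiv ℝ F (q • ω + (y : EuclideanSpace ℝ (Fin d))) ω⟫)
    (Metric.closedBall_mem_nhds p one_pos) ?_ ?_ ?_ ?_ ?_ ?_).2
  · refine Filter.Eventually.of_forall fun q => Continuous.aestronglyMeasurable ?_
    fun_prop
  · refine Continuous.integrable_of_hasCompactSupport (by fun_prop) hs.mul_right
  · refine Continuous.aestronglyMeasurable ?_
    fun_prop
  · refine Filter.Eventually.of_forall fun y q hq => ?_
    rw [norm_mul]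
    by_cases hy : y ∈ tsupport χ
    · exact mul_le_mul_of_nonneg_left (hM (q, y) ⟨hq, hy⟩) (norm_nonneg _)
    · simp [image_eq_zero_of_notMem_tsupport hy]
  · exact Continuous.integrable_of_hasCompactSupport (by fun_prop) hs.norm.mul_right
  · refine Filter.Eventually.of_forall fun y q hq => ?_
    have hF : DifferentiableAt ℝ F (q • ω + (y : EuclideanSpace ℝ (Fin d))) :=
      hreg.differentiable one_ne_zero _
    have h1 : HasDerivAt (fun q : ℝ => q • ω + (y : EuclideanSpace ℝ (Fin d))) ω q := by
      simpa using ((hasDerivAt_id q).smul_const ω).add_const (y : EuclideanSpace ℝ (Fin d))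
    have h2 := hF.hasFDerivAt.comp_hasDerivAt q h1
    have h3 := (innerSL ℝ ω).hasFDerivAt.comp_hasDerivAt q h2
    exact h3.const_mul (χ y)

/-- Integration by parts in a direction tangent to the hyperplane. -/
lemma flux_ibp {d : ℕ} {F : EuclideanSpace ℝ (Fin d) → EuclideanSpace ℝ (Fin d)}
    (hreg : ContDiff ℝ 1 F) (ω : EuclideanSpace ℝ (Fin d))
    {χ : ((ℝ ∙ ω)ᗮ : Submodule ℝ (EuclideanSpace ℝ (Fin d))) → ℝ}
    (hχ : ContDiff ℝ 1 χ) (hs : HasCompactSupport χ) (p : ℝ)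
    (v : ((ℝ ∙ ω)ᗮ : Submodule ℝ (EuclideanSpace ℝ (Fin d)))) :
    Integrable (fun y : ((ℝ ∙ ω)ᗮ : Submodule ℝ (EuclideanSpace ℝ (Fin d))) =>
        χ y * ⟪(v : EuclideanSpace ℝ (Fin d)),
          fderiv ℝ F (p • ω + (y : EuclideanSpace ℝ (Fin d))) v⟫) ∧
    ∫ y : ((ℝ ∙ ω)ᗮ : Submodule ℝ (EuclideanSpace ℝ (Fin d))),
        χ y * ⟪(v : EuclideanSpace ℝ (Fin d)),
          fderiv ℝ F (p • ω + (y : EuclideanSpace ℝ (Fin d))) v⟫ =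
      - ∫ y : ((ℝ ∙ ω)ᗮ : Submodule ℝ (EuclideanSpace ℝ (Fin d))),
        fderiv ℝ χ y v * ⟪(v : EuclideanSpace ℝ (Fin d)),
          F (p • ω + (y : EuclideanSpace ℝ (Fin d)))⟫ := by
  have hFc := hreg.continuous
  have hDc : Continuous (fderiv ℝ F) := hreg.continuous_fderiv one_ne_zero
  have hχc := hχ.continuous
  have hχd : Continuous (fderiv ℝ χ) := hχ.continuous_fderiv one_ne_zero
  let g : ((ℝ ∙ ω)ᗮ : Submodule ℝ (EuclideanSpace ℝ (Fin d))) → ℝ := fun y =>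
    ⟪(v : EuclideanSpace ℝ (Fin d)), F (p • ω + (y : EuclideanSpace ℝ (Fin d)))⟫
  have hg : ∀ y : ((ℝ ∙ ω)ᗮ : Submodule ℝ (EuclideanSpace ℝ (Fin d))),
      HasFDerivAt g (((innerSL ℝ (v : EuclideanSpace ℝ (Fin d))).comp
      (fderiv ℝ F (p • ω + (y : EuclideanSpace ℝ (Fin d))))).comp
        ((ℝ ∙ ω)ᗮ : Submodule ℝ (EuclideanSpace ℝ (Fin d))).subtypeL) y := by
    intro y
    have hF : DifferentiableAt ℝ F (p • ω + (y : EuclideanSpace ℝ (Fin d))) :=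
      hreg.differentiable one_ne_zero _
    have h1 : HasFDerivAt (fun y : ((ℝ ∙ ω)ᗮ : Submodule ℝ (EuclideanSpace ℝ (Fin d))) =>
        p • ω + (y : EuclideanSpace ℝ (Fin d)))
        ((ℝ ∙ ω)ᗮ : Submodule ℝ (EuclideanSpace ℝ (Fin d))).subtypeL y :=
      (((ℝ ∙ ω)ᗮ : Submodule ℝ (EuclideanSpace ℝ (Fin d))).subtypeL.hasFDerivAt).const_add (p • ω)
    exact (innerSL ℝ (v : EuclideanSpace ℝ (Fin d))).hasFDerivAt.comp y
      (hF.hasFDerivAt.comp y h1)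
  have hg' : ∀ y : ((ℝ ∙ ω)ᗮ : Submodule ℝ (EuclideanSpace ℝ (Fin d))),
      fderiv ℝ g y v = ⟪(v : EuclideanSpace ℝ (Fin d)),
          fderiv ℝ F (p • ω + (y : EuclideanSpace ℝ (Fin d))) v⟫ := by
    intro y
    rw [(hg y).fderiv]
    simp
  have hgc : Continuous g := by fun_prop
  have hint : Integrable (fun y : ((ℝ ∙ ω)ᗮ : Submodule ℝ (EuclideanSpace ℝ (Fin d))) =>
        χ y * ⟪(v : EuclideanSpace ℝ (Fin d)),
          fderiv ℝ F (p • ω + (y : EuclideanSpace ℝ (Fin d))) v⟫) :=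
    Continuous.integrable_of_hasCompactSupport (by fun_prop) hs.mul_right
  refine ⟨hint, ?_⟩
  have := integral_mul_fderiv_eq_neg_fderiv_mul_of_integrable (μ := volume) (f := χ) (g := g)
    (v := v) (Continuous.integrable_of_hasCompactSupport (by fun_prop)
      (hs.fderiv_apply ℝ v).mul_right) (by simpa only [hg'] using hint)
    (Continuous.integrable_of_hasCompactSupport (by fun_prop) hs.mul_right)
    (fun x _ => hχ.differentiable one_ne_zero x) (fun x _ => (hg x).differentiableAt)
  simpa only [hg'] using this

/-- the transversal Radon transform of a `C¹` solenoidal vector field decaying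
like `(1+‖x‖)^{−d}` vanishes identically. -/
theorem stmt5 (d : ℕ) (hd : 2 ≤ d)
    (F : EuclideanSpace ℝ (Fin d) → EuclideanSpace ℝ (Fin d))
    (hreg : ContDiff ℝ 1 F)
    (hsol : ∀ x, vdiv F x = 0)
    (C : ℝ) (hC : 0 ≤ C)
    (hFb : ∀ x, ‖F x‖ ≤ C * (1 + ‖x‖) ^ (-(d : ℝ))) :
    ∀ ω : EuclideanSpace ℝ (Fin d), ‖ω‖ = 1 → ∀ p : ℝ, Dperp F ω p = 0 := by
  intro ω hω
  have hd0 : 0 < d := by omega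
  let H : Submodule ℝ (EuclideanSpace ℝ (Fin d)) := (ℝ ∙ ω)ᗮ
  have hFc := hreg.continuous
  -- an orthonormal basis containing ω
  let i0 : Fin d := ⟨0, hd0⟩
  obtain ⟨b, hb⟩ : ∃ b : OrthonormalBasis (Fin d) ℝ (EuclideanSpace ℝ (Fin d)), b i0 = ω := by
    obtain ⟨b, hb⟩ := Orthonormal.exists_orthonormalBasis_extension_of_card_eq (𝕜 := ℝ)
      (E := EuclideanSpace ℝ (Fin d)) (ι := Fin d) (by simp) (v := fun _ => ω) (s := {i0})
      (by
        rw [orthonormal_iff_ite]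
        rintro ⟨i, rfl⟩ ⟨j, rfl⟩
        simp [hω])
    exact ⟨b, hb i0 rfl⟩
  have hbm : ∀ j, j ≠ i0 → b j ∈ H := by
    intro j hj
    rw [Submodule.mem_orthogonal_singleton_iff_inner_right, ← hb]
    exact b.orthonormal.2 hj.symm
  -- decay on hyperplanes
  have hle : ∀ (p : ℝ) (y : H), ‖(y : EuclideanSpace ℝ (Fin d))‖ ^ 2 + p ^ 2
      = ‖p • ω + (y : EuclideanSpace ℝ (Fin d))‖ ^ 2 := by
    intro p y
    have h0 : ⟪ω, (y : EuclideanSpace ℝ (Fin d))⟫ = 0 :=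
      Submodule.mem_orthogonal_singleton_iff_inner_right.1 y.2
    rw [norm_add_sq_real, inner_smul_left, h0, norm_smul, hω]
    simp
    ring
  have hmono : ∀ a c : ℝ, 0 ≤ a → a ≤ c → (1 + c) ^ (-(d : ℝ)) ≤ (1 + a) ^ (-(d : ℝ)) := by
    intro a c ha hac
    exact Real.rpow_le_rpow_of_nonpos (by linarith) (by linarith) (by simp)
  let B : H → ℝ := fun y => C * (1 + ‖y‖) ^ (-(d : ℝ))
  have hB0 : ∀ y, 0 ≤ B y := fun y => by positivity
  have hFB : ∀ (p : ℝ) (y : H), ‖F (p • ω + (y : EuclideanSpace ℝ (Fin d)))‖ ≤ B y := by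
    intro p y
    refine (hFb _).trans (mul_le_mul_of_nonneg_left (hmono _ _ (norm_nonneg _) ?_) hC)
    refine le_of_sq_le_sq ?_ (norm_nonneg _)
    rw [← hle p y]
    have : ‖y‖ = ‖(y : EuclideanSpace ℝ (Fin d))‖ := rfl
    rw [this]
    nlinarith [sq_nonneg p]
  have hωB : ∀ (v : EuclideanSpace ℝ (Fin d)), ‖v‖ = 1 → ∀ (p : ℝ) (y : H),
      ‖⟪v, F (p • ω + (y : EuclideanSpace ℝ (Fin d)))⟫‖ ≤ B y := by
    intro v hv p y
    refine (norm_inner_le_norm _ _).trans ?_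
    rw [hv, one_mul]
    exact hFB p y
  have hBint : Integrable B := by
    refine (integrable_one_add_norm ?_).const_mul C
    have h1 : H ≠ ⊤ := by
      intro h
      have h2 : ω ∈ H := h ▸ Submodule.mem_top
      have h3 := Submodule.mem_orthogonal_singleton_iff_inner_right.1 h2
      rw [real_inner_self_eq_norm_sq, hω] at h3
      norm_num at h3
    have h2 := Submodule.finrank_lt h1
    rw [finrank_euclideanSpace_fin] at h2
    exact_mod_cast h2
  obtain ⟨χ, K, hK, hχ, hs, hχ1, hχt, hχd⟩ := exists_cutoffs H
  let G : ℕ → ℝ → ℝ := fun n q => ∫ y : H, χ n y * ⟪ω, F (q • ω + (y : EuclideanSpace ℝ (Fin d)))⟫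
  let G' : ℕ → ℝ → ℝ := fun n q =>
    ∫ y : H, χ n y * ⟪ω, fderiv ℝ F (q • ω + (y : EuclideanSpace ℝ (Fin d))) ω⟫
  have hG : ∀ n q, HasDerivAt (G n) (G' n q) q := fun n q =>
    hasDerivAt_flux hreg ω (hχ n) (hs n) q
  have hGlim : ∀ q, Filter.Tendsto (fun n => G n q) Filter.atTop (nhds (Dperp F ω q)) := by
    intro q
    refine tendsto_integral_of_dominated_convergence B ?_ hBint ?_ ?_
    · intro n
      have := (hχ n).continuous
      refine Continuous.aestronglyMeasurable ?_
      fun_prop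
    · refine fun n => Filter.Eventually.of_forall fun y => ?_
      rw [norm_mul]
      calc _ ≤ 1 * B y := mul_le_mul (hχ1 n y) (hωB ω hω q y) (norm_nonneg _) zero_le_one
        _ = B y := one_mul _
    · refine Filter.Eventually.of_forall fun y => ?_
      simpa using (hχt y).mul_const ⟪ω, F (q • ω + (y : EuclideanSpace ℝ (Fin d)))⟫
  -- the derivative bound
  let L : ℝ := ∑ _j ∈ Finset.univ.erase i0, K * ∫ y, B y
  have hG' : ∀ n q, ‖G' n q‖ ≤ L / ((n : ℝ) + 1) := by
    intro n q
    have e1 : G' n q = ∫ y : H, - ∑ j ∈ Finset.univ.erase i0,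
        χ n y * ⟪b j, fderiv ℝ F (q • ω + (y : EuclideanSpace ℝ (Fin d))) (b j)⟫ := by
      refine integral_congr_ae (Filter.Eventually.of_forall fun y => ?_)
      have h1 := vdiv_eq_sum hreg b (q • ω + (y : EuclideanSpace ℝ (Fin d)))
      rw [hsol, ← Finset.add_sum_erase _ _ (Finset.mem_univ i0), hb] at h1
      simp only
      rw [← Finset.mul_sum, ← mul_neg]
      congr 1
      linarith
    have e2 : G' n q = ∑ j ∈ Finset.univ.erase i0, - ∫ y : H,
        χ n y * ⟪b j, fderiv ℝ F (q • ω + (y : EuclideanSpace ℝ (Fin d))) (b j)⟫ := by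
      rw [e1, integral_neg, integral_finsetSum, Finset.sum_neg_distrib]
      intro j hj
      exact (flux_ibp hreg ω (hχ n) (hs n) q ⟨b j, hbm j (Finset.ne_of_mem_erase hj)⟩).1
    rw [e2, Finset.sum_div]
    refine norm_sum_le_of_le _ fun j hj => ?_
    have h1 := (flux_ibp hreg ω (hχ n) (hs n) q ⟨b j, hbm j (Finset.ne_of_mem_erase hj)⟩).2
    simp only at h1
    rw [h1, neg_neg]
    have h2 : K * (∫ y, B y) / ((n : ℝ) + 1) = ∫ y, K / ((n : ℝ) + 1) * B y := by
      rw [integral_const_mul (K / ((n : ℝ) + 1)) B]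
      exact mul_div_right_comm _ _ _
    rw [h2]
    refine norm_integral_le_of_norm_le (hBint.const_mul _)
      (Filter.Eventually.of_forall fun y => ?_)
    rw [norm_mul]
    refine mul_le_mul ?_ (hωB _ (b.orthonormal.1 j) q y) (norm_nonneg _) (by positivity)
    refine ((fderiv ℝ (χ n) y).le_opNorm _).trans ?_
    have h3 : ‖(⟨b j, hbm j (Finset.ne_of_mem_erase hj)⟩ : H)‖ = 1 := b.orthonormal.1 j
    rw [h3, mul_one]
    exact hχd n y
  -- the flux is constant
  have hconst : ∀ p q, Dperp F ω q = Dperp F ω p := by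
    intro p q
    have h1 : ∀ n, ‖G n q - G n p‖ ≤ L / ((n : ℝ) + 1) * ‖q - p‖ := fun n =>
      Convex.norm_image_sub_le_of_norm_hasDerivWithin_le (𝕜 := ℝ) (s := Set.univ)
        (fun x _ => (hG n x).hasDerivWithinAt) (fun x _ => hG' n x) convex_univ
        (Set.mem_univ _) (Set.mem_univ _)
    have h2 : Filter.Tendsto (fun n : ℕ => L / ((n : ℝ) + 1) * ‖q - p‖) Filter.atTop (nhds 0) := by
      have : Filter.Tendsto (fun n : ℕ => L / ((n : ℝ) + 1)) Filter.atTop (nhds 0) := by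
        have := (tendsto_one_div_add_atTop_nhds_zero_nat (𝕜 := ℝ)).const_mul L
        simpa [div_eq_mul_inv] using this
      simpa using this.mul_const ‖q - p‖
    have h3 := squeeze_zero_norm h1 h2
    have h4 := (hGlim q).sub (hGlim p)
    exact sub_eq_zero.1 (tendsto_nhds_unique h4 h3)
  -- the flux tends to zero
  have hzero : Filter.Tendsto (fun n : ℕ => Dperp F ω (n : ℝ)) Filter.atTop (nhds 0) := by
    have : (0 : ℝ) = ∫ _y : H, (0 : ℝ) := by simp
    rw [this]
    refine tendsto_integral_of_dominated_convergence B ?_ hBint ?_ ?_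
    · intro n
      refine Continuous.aestronglyMeasurable ?_
      fun_prop
    · exact fun n => Filter.Eventually.of_forall fun y => hωB ω hω n y
    · refine Filter.Eventually.of_forall fun y => ?_
      have hb : ∀ n : ℕ, ‖⟪ω, F ((n : ℝ) • ω + (y : EuclideanSpace ℝ (Fin d)))⟫‖
          ≤ C * (1 + (n : ℝ)) ^ (-(d : ℝ)) := by
        intro n
        refine (norm_inner_le_norm _ _).trans ?_
        rw [hω, one_mul]
        refine (hFb _).trans (mul_le_mul_of_nonneg_left (hmono _ _ (by positivity) ?_) hC)
        refine le_of_sq_le_sq ?_ (norm_nonneg _)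
        rw [← hle n y]
        nlinarith [sq_nonneg ‖(y : EuclideanSpace ℝ (Fin d))‖]
      refine squeeze_zero_norm hb ?_
      have h1 : Filter.Tendsto (fun n : ℕ => 1 + (n : ℝ)) Filter.atTop Filter.atTop :=
        Filter.tendsto_atTop_add_const_left _ _ tendsto_natCast_atTop_atTop
      have h2 := (tendsto_rpow_neg_atTop (y := (d : ℝ)) (by exact_mod_cast hd0)).comp h1
      simpa using h2.const_mul C
  intro p
  have h5 : Filter.Tendsto (fun n : ℕ => Dperp F ω (n : ℝ)) Filter.atTop
      (nhds (Dperp F ω p)) := by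
    simp only [hconst p]
    exact tendsto_const_nhds
  exact tendsto_nhds_unique h5 hzero
end
end

section
/- Let d ≥ 2 and let H : EuclideanSpace ℝ (Fin d) → EuclideanSpace ℝ (Fin d) be a continuously differentiable vector field such that ‖H(x)‖ ≤ C·(1+‖x‖)^{-d} and ‖fderiv ℝ H x‖ ≤ C·(1+‖x‖)^{-d} for all x and some constant C ≥ 0. Then for every unit vector ω and every p ∈ ℝ, the function q ↦ [D^⊥H](ω,q) is differentiable at p with derivative equal to the Radon transform of the divergence: d/dp [D^⊥H](ω,p) = [R(div H)](ω,p). -/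
open MeasureTheory Real
open scoped RealInnerProductSpace

noncomputable section

theorem stmt6_bound (d : ℕ) (C : ℝ) (hC : 0 ≤ C) (ω : EuclideanSpace ℝ (Fin d))
    (q : ℝ) (y : ((ℝ ∙ ω)ᗮ : Submodule ℝ (EuclideanSpace ℝ (Fin d)))) :
    C * (1 + ‖q • ω + (y : EuclideanSpace ℝ (Fin d))‖) ^ (-(d : ℝ))
      ≤ C * (1 + ‖y‖) ^ (-(d : ℝ)) := by
  have h0 : ⟪q • ω, (y : EuclideanSpace ℝ (Fin d))⟫ = 0 := by
    rw [inner_smul_left, Submodule.mem_orthogonal_singleton_iff_inner_right.1 y.2, mul_zero]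
  have h1 := norm_add_sq_eq_norm_sq_add_norm_sq_of_inner_eq_zero _ _ h0
  have h2 : ‖y‖ ≤ ‖q • ω + (y : EuclideanSpace ℝ (Fin d))‖ := by
    rw [Submodule.coe_norm]
    refine (sq_le_sq₀ (norm_nonneg _) (norm_nonneg _)).1 ?_
    nlinarith [norm_nonneg (q • ω)]
  apply mul_le_mul_of_nonneg_left _ hC
  apply Real.rpow_le_rpow_of_nonpos (by positivity) (by linarith)
  simp

/-- derivative in `p` of the transversal transform equals the Radon transform
of the divergence: `d/dp [D^⊥H](ω,p) = [R(div H)](ω,p)`. -/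
theorem stmt6 (d : ℕ) (hd : 2 ≤ d)
    (H : EuclideanSpace ℝ (Fin d) → EuclideanSpace ℝ (Fin d))
    (hreg : ContDiff ℝ 1 H)
    (C : ℝ) (hC : 0 ≤ C)
    (hHb : ∀ x, ‖H x‖ ≤ C * (1 + ‖x‖) ^ (-(d : ℝ)))
    (hHdb : ∀ x, ‖fderiv ℝ H x‖ ≤ C * (1 + ‖x‖) ^ (-(d : ℝ))) :
    ∀ ω : EuclideanSpace ℝ (Fin d), ‖ω‖ = 1 → ∀ p : ℝ,
      HasDerivAt (fun q => Dperp H ω q) (RadonT (vdiv H) ω p) p := by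
  intro ω hω p
  have hω0 : ω ≠ 0 := by rintro rfl; simp at hω
  have hdiff : Differentiable ℝ H := hreg.differentiable (by simp)
  have hcH : Continuous H := hreg.continuous
  have hcD : Continuous (fderiv ℝ H) := hreg.continuous_fderiv (by simp)
  have hfin : (Module.finrank ℝ ((ℝ ∙ ω)ᗮ : Submodule ℝ (EuclideanSpace ℝ (Fin d))) : ℝ) < d := by
    have h1 := (ℝ ∙ ω).finrank_add_finrank_orthogonal
    rw [finrank_span_singleton hω0, finrank_euclideanSpace_fin] at h1
    exact_mod_cast (by omega)
  have hB : Integrable (fun y : ((ℝ ∙ ω)ᗮ : Submodule ℝ (EuclideanSpace ℝ (Fin d))) =>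
      C * (1 + ‖y‖) ^ (-(d : ℝ))) := (integrable_one_add_norm hfin).const_mul C
  have hbH : ∀ (a : EuclideanSpace ℝ (Fin d)) (q : ℝ)
      (y : ((ℝ ∙ ω)ᗮ : Submodule ℝ (EuclideanSpace ℝ (Fin d)))),
      ‖⟪a, H (q • ω + (y : EuclideanSpace ℝ (Fin d)))⟫‖
        ≤ ‖a‖ * (C * (1 + ‖y‖) ^ (-(d : ℝ))) := fun a q y =>
    (norm_inner_le_norm _ _).trans (mul_le_mul_of_nonneg_left
      ((hHb _).trans (stmt6_bound d C hC ω q y)) (norm_nonneg _))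
  have hbD : ∀ (a v : EuclideanSpace ℝ (Fin d)) (q : ℝ)
      (y : ((ℝ ∙ ω)ᗮ : Submodule ℝ (EuclideanSpace ℝ (Fin d)))),
      ‖⟪a, fderiv ℝ H (q • ω + (y : EuclideanSpace ℝ (Fin d))) v⟫‖
        ≤ ‖a‖ * ((C * (1 + ‖y‖) ^ (-(d : ℝ))) * ‖v‖) := fun a v q y =>
    (norm_inner_le_norm _ _).trans (mul_le_mul_of_nonneg_left
      ((ContinuousLinearMap.le_opNorm _ _).trans (mul_le_mul_of_nonneg_right
        ((hHdb _).trans (stmt6_bound d C hC ω q y)) (norm_nonneg _))) (norm_nonneg _))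
  have hiH : ∀ (a : EuclideanSpace ℝ (Fin d)) (q : ℝ), Integrable
      (fun y : ((ℝ ∙ ω)ᗮ : Submodule ℝ (EuclideanSpace ℝ (Fin d))) =>
        ⟪a, H (q • ω + (y : EuclideanSpace ℝ (Fin d)))⟫) := fun a q =>
    (hB.const_mul ‖a‖).mono' (Continuous.aestronglyMeasurable (by fun_prop))
      (Filter.Eventually.of_forall (hbH a q))
  have hcDv : ∀ (a v : EuclideanSpace ℝ (Fin d)) (q : ℝ), Continuous
      (fun y : ((ℝ ∙ ω)ᗮ : Submodule ℝ (EuclideanSpace ℝ (Fin d))) =>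
        ⟪a, fderiv ℝ H (q • ω + (y : EuclideanSpace ℝ (Fin d))) v⟫) := fun a v q => by
    fun_prop
  have hiD : ∀ (a v : EuclideanSpace ℝ (Fin d)) (q : ℝ), Integrable
      (fun y : ((ℝ ∙ ω)ᗮ : Submodule ℝ (EuclideanSpace ℝ (Fin d))) =>
        ⟪a, fderiv ℝ H (q • ω + (y : EuclideanSpace ℝ (Fin d))) v⟫) := fun a v q =>
    ((hB.mul_const ‖v‖).const_mul ‖a‖).mono' (hcDv a v q).aestronglyMeasurable
      (Filter.Eventually.of_forall (hbD a v q))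
  -- tangential derivatives integrate to zero
  have hzero : ∀ (a : EuclideanSpace ℝ (Fin d))
      (v : ((ℝ ∙ ω)ᗮ : Submodule ℝ (EuclideanSpace ℝ (Fin d)))),
      ∫ y : ((ℝ ∙ ω)ᗮ : Submodule ℝ (EuclideanSpace ℝ (Fin d))),
        ⟪a, fderiv ℝ H (p • ω + (y : EuclideanSpace ℝ (Fin d))) (v : EuclideanSpace ℝ (Fin d))⟫
        = 0 := by
    intro a v
    have hg : ∀ y : ((ℝ ∙ ω)ᗮ : Submodule ℝ (EuclideanSpace ℝ (Fin d))), HasFDerivAt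
        (fun y : ((ℝ ∙ ω)ᗮ : Submodule ℝ (EuclideanSpace ℝ (Fin d))) =>
          ⟪a, H (p • ω + (y : EuclideanSpace ℝ (Fin d)))⟫)
        ((innerSL ℝ a).comp ((fderiv ℝ H (p • ω + (y : EuclideanSpace ℝ (Fin d)))).comp
          (ℝ ∙ ω)ᗮ.subtypeL)) y := by
      intro y
      have h1 : HasFDerivAt (fun y : ((ℝ ∙ ω)ᗮ : Submodule ℝ (EuclideanSpace ℝ (Fin d))) =>
          p • ω + (y : EuclideanSpace ℝ (Fin d))) ((ℝ ∙ ω)ᗮ.subtypeL) y :=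
        ((ℝ ∙ ω)ᗮ.subtypeL.hasFDerivAt).const_add _
      exact (innerSL ℝ a).hasFDerivAt.comp y ((hdiff _).hasFDerivAt.comp y h1)
    have key := integral_bilinear_hasFDerivAt_right_eq_neg_left_of_integrable
      (μ := (volume : Measure ((ℝ ∙ ω)ᗮ : Submodule ℝ (EuclideanSpace ℝ (Fin d)))))
      (f := fun _ => (1 : ℝ)) (f' := fun _ => 0) (v := v) (B := ContinuousLinearMap.mul ℝ ℝ)
      (g := fun y => ⟪a, H (p • ω + (y : EuclideanSpace ℝ (Fin d)))⟫)
      (g' := fun y => (innerSL ℝ a).comp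
        ((fderiv ℝ H (p • ω + (y : EuclideanSpace ℝ (Fin d)))).comp (ℝ ∙ ω)ᗮ.subtypeL))
      (by simp) (by simpa using hiD a v p) (by simpa using hiH a p)
      (fun x _ => hasFDerivAt_const _ _) (fun x _ => hg x)
    simpa using key
  have hdiv : ∀ x, vdiv H x = ⟪ω, fderiv ℝ H x ω⟫ + ∑ j, ⟪canE d j, fderiv ℝ H x
      (((ℝ ∙ ω)ᗮ.orthogonalProjection (canE d j) :
        ((ℝ ∙ ω)ᗮ : Submodule ℝ (EuclideanSpace ℝ (Fin d)))) : EuclideanSpace ℝ (Fin d))⟫ := by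
    intro x
    have h1 : ∀ j, fderiv ℝ (fun y => ⟪canE d j, H y⟫) x (canE d j)
        = ⟪canE d j, fderiv ℝ H x (canE d j)⟫ := fun j => by
      have : HasFDerivAt (fun y => ⟪canE d j, H y⟫)
        ((innerSL ℝ (canE d j)).comp (fderiv ℝ H x)) x :=
        (innerSL ℝ (canE d j)).hasFDerivAt.comp x (hdiff x).hasFDerivAt
      rw [this.fderiv]; rfl
    have h2 : ∀ j, canE d j = ⟪ω, canE d j⟫ • ω +
      (((ℝ ∙ ω)ᗮ.orthogonalProjection (canE d j) :
        ((ℝ ∙ ω)ᗮ : Submodule ℝ (EuclideanSpace ℝ (Fin d)))) : EuclideanSpace ℝ (Fin d)) := by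
      intro j
      have h3 := (ℝ ∙ ω).starProjection_add_starProjection_orthogonal (canE d j)
      rw [Submodule.starProjection_unit_singleton ℝ hω] at h3
      exact h3.symm
    have h4 : ⟪ω, fderiv ℝ H x ω⟫ = ∑ j, ⟪ω, canE d j⟫ * ⟪canE d j, fderiv ℝ H x ω⟫ := by
      rw [← (EuclideanSpace.basisFun (Fin d) ℝ).sum_inner_mul_inner]
      simp [canE]
    rw [h4, ← Finset.sum_add_distrib, vdiv]
    refine Finset.sum_congr rfl fun j _ => ?_
    rw [h1]
    conv_lhs => rw [show fderiv ℝ H x (canE d j) = _ from congrArg _ (h2 j)]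
    rw [map_add, map_smul, inner_add_right, inner_smul_right]
  have hR : RadonT (vdiv H) ω p = ∫ y : ((ℝ ∙ ω)ᗮ : Submodule ℝ (EuclideanSpace ℝ (Fin d))),
      ⟪ω, fderiv ℝ H (p • ω + (y : EuclideanSpace ℝ (Fin d))) ω⟫ := by
    simp only [RadonT, hdiv]
    rw [integral_add (hiD _ _ _) (integrable_finsetSum _ fun j _ => hiD _ _ _),
      integral_finsetSum _ fun j _ => hiD _ _ _]
    simp only [hzero, Finset.sum_const_zero, add_zero]
  rw [hR]
  refine (hasDerivAt_integral_of_dominated_loc_of_deriv_le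
    (F := fun q (y : ((ℝ ∙ ω)ᗮ : Submodule ℝ (EuclideanSpace ℝ (Fin d)))) =>
      ⟪ω, H (q • ω + (y : EuclideanSpace ℝ (Fin d)))⟫)
    (F' := fun q (y : ((ℝ ∙ ω)ᗮ : Submodule ℝ (EuclideanSpace ℝ (Fin d)))) =>
      ⟪ω, fderiv ℝ H (q • ω + (y : EuclideanSpace ℝ (Fin d))) ω⟫)
    (s := Set.univ) Filter.univ_mem
    (Filter.Eventually.of_forall fun q => (hiH ω q).aestronglyMeasurable) (hiH ω p)
    (hiD ω ω p).aestronglyMeasurable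
    (Filter.Eventually.of_forall fun y q _ => hbD ω ω q y)
    ((hB.mul_const ‖ω‖).const_mul ‖ω‖)
    (Filter.Eventually.of_forall fun y q _ => ?_)).2
  have h1 : HasDerivAt (fun q : ℝ => q • ω + (y : EuclideanSpace ℝ (Fin d))) ω q := by
    simpa using ((hasDerivAt_id q).smul_const ω).add_const (y : EuclideanSpace ℝ (Fin d))
  exact (innerSL ℝ ω).hasFDerivAt.comp_hasDerivAt q
    ((hdiff _).hasFDerivAt.comp_hasDerivAt q h1)
end
end

section
/- Let d ≥ 2 and let φ : EuclideanSpace ℝ (Fin d) → ℝ be continuously differentiable with |φ(x)| ≤ C·(1+‖x‖)^{1−d} and ‖∇φ(x)‖ ≤ C·(1+‖x‖)^{-d} for all x and some constant C ≥ 0. Then every longitudinal Radon transform of the potential field ∇φ vanishes: for every pair of orthonormal vectors ω, θ in ℝ^d and every p ∈ ℝ, ∫_{y ∈ (ℝ∙ω)ᗮ} ⟪θ, ∇φ(p•ω+y)⟫ dy = 0. -/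
open MeasureTheory Real
open scoped RealInnerProductSpace

noncomputable section

open Module Filter Topology in
/-- The integral of a directional derivative of a function vanishing at infinity is zero. -/
lemma integral_lineDeriv_eq_zero_of_tendsto {E : Type*} [NormedAddCommGroup E] [NormedSpace ℝ E]
    [MeasurableSpace E] [BorelSpace E] [FiniteDimensional ℝ E] {μ : Measure E}
    [μ.IsAddHaarMeasure] {g g' : E → ℝ} {v : E} (hv : v ≠ 0)
    (hg' : Integrable g' μ)
    (hg : ∀ x, ∀ t : ℝ, HasDerivAt (fun s : ℝ => g (x + s • v)) (g' (x + t • v)) t)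
    (h0 : Tendsto g (cocompact E) (𝓝 0)) : ∫ x, g' x ∂μ = 0 := by
  have : Nontrivial E := nontrivial_iff.2 ⟨v, 0, hv⟩
  let n := finrank ℝ E
  let E' := Fin (n - 1) → ℝ
  obtain ⟨L, hL⟩ : ∃ L : E ≃L[ℝ] (E' × ℝ), L v = (0, 1) := by
    have : finrank ℝ (E' × ℝ) = n := by simpa [this, E'] using Nat.sub_add_cancel finrank_pos
    have L₀ : E ≃L[ℝ] (E' × ℝ) := (ContinuousLinearEquiv.ofFinrankEq this).symm
    obtain ⟨M, hM⟩ : ∃ M : (E' × ℝ) ≃L[ℝ] (E' × ℝ), M (L₀ v) = (0, 1) := by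
      apply SeparatingDual.exists_continuousLinearEquiv_apply_eq
      · simpa using hv
      · simp
    exact ⟨L₀.trans M, by simp [hM]⟩
  let ν := Measure.map L μ
  have L_emb : MeasurableEmbedding L := L.toHomeomorph.measurableEmbedding
  have hν : ν.IsAddHaarMeasure := L.isAddHaarMeasure_map μ
  have hint : Integrable (fun x => g' (L.symm x)) ν := by
    simpa [ν, L_emb.integrable_map_iff, Function.comp_def] using hg'
  have heq : ∫ x, g' x ∂μ = ∫ x, g' (L.symm x) ∂ν := by
    simp [ν, L_emb.integral_map]
  rw [heq]
  let ρ : Measure E' := Measure.addHaar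
  have A : ρ.prod volume = (Measure.addHaarScalarFactor (ρ.prod volume) ν) • ν :=
    Measure.isAddLeftInvariant_eq_smul _ _
  have Hint : Integrable (fun x => g' (L.symm x)) (ρ.prod volume) := by
    rw [A]; exact hint.smul_measure_nnreal
  have key : ∫ x, g' (L.symm x) ∂(ρ.prod volume) = 0 := by
    rw [integral_prod _ Hint]
    rw [← integral_zero E' ℝ (μ := ρ)]
    apply integral_congr_ae
    filter_upwards [Hint.prod_right_ae] with x hx
    have hline : ∀ t : ℝ, L.symm (x, t) = L.symm (x, 0) + t • v := by
      intro t
      apply L.injective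
      simp [hL]
    have hcl : Topology.IsClosedEmbedding (fun t : ℝ => L.symm (x, t)) :=
      L.symm.toHomeomorph.isClosedEmbedding.comp 
        (Topology.IsClosedEmbedding.of_continuous_injective_isClosedMap (by fun_prop)
          (fun a b h => (Prod.ext_iff.1 h).2) (by
            intro K hK
            have : Set.image (fun t : ℝ => (x, t)) K = ({x} : Set E') ×ˢ K := by
              ext ⟨a, b⟩; simp [eq_comm, and_comm]
            rw [this]
            exact isClosed_singleton.prod hK))
    have ht := h0.comp hcl.tendsto_cocompact
    rw [cocompact_eq_atBot_atTop, tendsto_sup] at ht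
    have hd : ∀ t : ℝ, HasDerivAt (fun s : ℝ => g (L.symm (x, s))) (g' (L.symm (x, t))) t := by
      intro t
      have h := hg (L.symm (x, 0)) t
      simp only [← hline] at h
      exact h
    simpa using integral_of_hasDerivAt_of_tendsto hd hx ht.1 ht.2
  rw [Measure.isAddLeftInvariant_eq_smul ν (ρ.prod volume)]
  simp [key]

/-- every longitudinal Radon transform of a potential field `∇φ` vanishes. -/
theorem stmt7 (d : ℕ) (hd : 2 ≤ d)
    (φ : EuclideanSpace ℝ (Fin d) → ℝ) (hreg : ContDiff ℝ 1 φ)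
    (C : ℝ) (hC : 0 ≤ C)
    (hφb : ∀ x, |φ x| ≤ C * (1 + ‖x‖) ^ ((1 : ℝ) - d))
    (hgradb : ∀ x, ‖gradient φ x‖ ≤ C * (1 + ‖x‖) ^ (-(d : ℝ))) :
    ∀ ω θ : EuclideanSpace ℝ (Fin d), ‖ω‖ = 1 → ‖θ‖ = 1 → ⟪ω, θ⟫ = 0 → ∀ p : ℝ,
      Dlong (fun x => gradient φ x) ω θ p = 0 := by
  intro ω θ hω hθ hωθ p
  unfold Dlong RadonT
  have hdR : (2 : ℝ) ≤ d := by exact_mod_cast hd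
  have hθV : θ ∈ ((ℝ ∙ ω)ᗮ : Submodule ℝ (EuclideanSpace ℝ (Fin d))) :=
    Submodule.mem_orthogonal_singleton_iff_inner_right.2 hωθ
  have hnorm : ∀ y : ((ℝ ∙ ω)ᗮ : Submodule ℝ (EuclideanSpace ℝ (Fin d))),
      ‖y‖ ≤ ‖p • ω + (y : EuclideanSpace ℝ (Fin d))‖ := by
    intro y
    have h1 : ⟪p • ω, (y : EuclideanSpace ℝ (Fin d))⟫ = 0 := by
      rw [inner_smul_left, Submodule.mem_orthogonal_singleton_iff_inner_right.1 y.2, mul_zero]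
    have h2 := norm_add_sq_eq_norm_sq_add_norm_sq_of_inner_eq_zero _ _ h1
    rw [Submodule.coe_norm]
    nlinarith [norm_nonneg (p • ω + (y : EuclideanSpace ℝ (Fin d))),
      norm_nonneg (y : EuclideanSpace ℝ (Fin d)), norm_nonneg (p • ω)]
  have hmono : ∀ r : ℝ, r ≤ 0 → ∀ y : ((ℝ ∙ ω)ᗮ : Submodule ℝ (EuclideanSpace ℝ (Fin d))),
      C * (1 + ‖p • ω + (y : EuclideanSpace ℝ (Fin d))‖) ^ r ≤ C * (1 + ‖y‖) ^ r := by
    intro r hr y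
    apply mul_le_mul_of_nonneg_left _ hC
    exact Real.rpow_le_rpow_of_nonpos (by positivity) (by linarith [hnorm y]) hr
  have hgcont : Continuous (fun x => gradient φ x) := by
    unfold gradient
    exact (LinearIsometryEquiv.continuous _).comp (hreg.continuous_fderiv one_ne_zero)
  refine integral_lineDeriv_eq_zero_of_tendsto
    (g := fun y : ((ℝ ∙ ω)ᗮ : Submodule ℝ (EuclideanSpace ℝ (Fin d))) =>
      φ (p • ω + (y : EuclideanSpace ℝ (Fin d)))) (v := ⟨θ, hθV⟩) ?_ ?_ ?_ ?_
  · intro h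
    have : θ = 0 := congrArg Subtype.val h
    simp [this] at hθ
  · have hfr : Module.finrank ℝ ((ℝ ∙ ω)ᗮ : Submodule ℝ (EuclideanSpace ℝ (Fin d))) < d := by
      have h1 := Submodule.finrank_add_finrank_orthogonal (ℝ ∙ ω)
      rw [finrank_span_singleton (by rintro rfl; simp at hω), finrank_euclideanSpace_fin] at h1
      omega
    have hI := (integrable_one_add_norm
      (E := ((ℝ ∙ ω)ᗮ : Submodule ℝ (EuclideanSpace ℝ (Fin d)))) (μ := volume) (r := (d : ℝ))
      (by exact_mod_cast hfr)).const_mul C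
    refine hI.mono' ?_ ?_
    · apply Continuous.aestronglyMeasurable
      exact continuous_const.inner (hgcont.comp (by fun_prop))
    · refine Filter.Eventually.of_forall fun y => ?_
      refine (norm_inner_le_norm _ _).trans ?_
      rw [hθ, one_mul]
      exact (hgradb _).trans (hmono _ (by linarith) y)
  · intro y t
    have hdiff := (hreg.differentiable one_ne_zero)
      (p • ω + ((y + t • (⟨θ, hθV⟩ : ((ℝ ∙ ω)ᗮ : Submodule ℝ (EuclideanSpace ℝ (Fin d)))) :
        ((ℝ ∙ ω)ᗮ : Submodule ℝ (EuclideanSpace ℝ (Fin d)))) : EuclideanSpace ℝ (Fin d)))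
    have hl : HasDerivAt (fun s : ℝ =>
        p • ω + ((y : EuclideanSpace ℝ (Fin d)) + s • θ)) θ t := by
      simpa using (((hasDerivAt_id t).smul_const θ).const_add
        (y : EuclideanSpace ℝ (Fin d))).const_add (p • ω)
    have := hdiff.hasFDerivAt.comp_hasDerivAt t hl
    beta_reduce
    rw [real_inner_comm, gradient, InnerProductSpace.toDual_symm_apply]
    exact this
  · have hlim : Filter.Tendsto
        (fun y : ((ℝ ∙ ω)ᗮ : Submodule ℝ (EuclideanSpace ℝ (Fin d))) =>
          C * (1 + ‖y‖) ^ ((1 : ℝ) - d)) (Filter.cocompact _) (nhds 0) := by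
      have h1 := (tendsto_rpow_neg_atTop (y := (d : ℝ) - 1) (by linarith)).comp
        (Filter.tendsto_atTop_add_const_left _ (1 : ℝ) (tendsto_norm_cocompact_atTop
          (E := ((ℝ ∙ ω)ᗮ : Submodule ℝ (EuclideanSpace ℝ (Fin d))))))
      simpa [Function.comp_def] using h1.const_mul C
    refine squeeze_zero_norm (fun y => ?_) hlim
    exact (hφb _).trans (hmono _ (by linarith) y)
end
end

section
/- Let d ≥ 2 and let φ : EuclideanSpace ℝ (Fin d) → ℝ be continuously differentiable with |φ(x)| ≤ C·(1+‖x‖)^{1−d} and ‖∇φ(x)‖ ≤ C·(1+‖x‖)^{-d} for all x and some constant C ≥ 0. Then the componentwise Radon transform of the potential field ∇φ is directed along the normal: for every unit vector ω and every p ∈ ℝ, ∫_{y ∈ (ℝ∙ω)ᗮ} ∇φ(p•ω+y) dy = (∫_{y ∈ (ℝ∙ω)ᗮ} ⟪ω, ∇φ(p•ω+y)⟫ dy) • ω. -/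
open MeasureTheory Real
open scoped RealInnerProductSpace

noncomputable section

lemma key_aux1 (r ε : ℝ) (hr : 0 ≤ r) (hε : 0 < ε) :
    (1 + ε * r ^ 2)⁻¹ ≤ (2 + 1 / ε) * (1 + r)⁻¹ := by
  rw [← div_eq_mul_inv, inv_eq_one_div, div_le_div_iff₀ (by positivity) (by positivity)]
  have h : (2 + 1 / ε) * (1 + ε * r ^ 2) = 2 + 1 / ε + 2 * ε * r ^ 2 + r ^ 2 := by
    field_simp
    ring
  have h1 : 0 < 1 / ε := by positivity
  have h2 : 0 ≤ 2 * ε * r ^ 2 := by positivity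
  rw [h]
  nlinarith [sq_nonneg (r - 1), sq_nonneg r]

lemma key_aux2 (r ε : ℝ) (hr : 0 ≤ r) (hε : 0 < ε) (hε1 : ε ≤ 1) :
    2 * ε * r / (1 + ε * r ^ 2) ^ 2 ≤ 4 * (1 + r)⁻¹ := by
  rw [← div_eq_mul_inv, div_le_div_iff₀ (by positivity) (by positivity)]
  have h2 : 0 ≤ ε * r ^ 2 := by positivity
  have h3 : 0 ≤ ε * (r - 1) ^ 2 := by positivity
  nlinarith [sq_nonneg (ε * r ^ 2)]

lemma key_int {V : Type*} [NormedAddCommGroup V] [InnerProductSpace ℝ V] [FiniteDimensional ℝ V]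
    [MeasurableSpace V] [BorelSpace V] (g : V → ℝ) (hg : ContDiff ℝ 1 g) (C : ℝ) (hC : 0 ≤ C)
    (h0 : ∀ y, |g y| ≤ C * (1 + ‖y‖) ^ (-(Module.finrank ℝ V : ℝ)))
    (h1 : ∀ y, ‖fderiv ℝ g y‖ ≤ C * (1 + ‖y‖) ^ (-((Module.finrank ℝ V : ℝ) + 1))) (v : V) :
    ∫ y, fderiv ℝ g y v = 0 := by
  set n : ℝ := (Module.finrank ℝ V : ℝ) with hn
  have hJ : Integrable (fun y : V => (1 + ‖y‖) ^ (-(n + 1))) :=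
    integrable_one_add_norm (by rw [← hn]; linarith)
  have hJe : ∀ y : V, (1 + ‖y‖) ^ (-(n + 1)) = (1 + ‖y‖) ^ (-n) * (1 + ‖y‖)⁻¹ := by
    intro y
    have : 0 < 1 + ‖y‖ := by positivity
    rw [neg_add, Real.rpow_add this, Real.rpow_neg_one]
  have hdc : Continuous (fun y => fderiv ℝ g y v) :=
    (hg.continuous_fderiv one_ne_zero).clm_apply continuous_const
  have hb1 : ∀ y, ‖fderiv ℝ g y v‖ ≤ C * ‖v‖ * (1 + ‖y‖) ^ (-(n + 1)) := by
    intro y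
    calc _ ≤ ‖fderiv ℝ g y‖ * ‖v‖ := ContinuousLinearMap.le_opNorm _ _
      _ ≤ (C * (1 + ‖y‖) ^ (-(n + 1))) * ‖v‖ := by gcongr; exact h1 y
      _ = _ := by ring
  have hJ1 := hJ.const_mul (C * ‖v‖)
  let ψ : ℝ → V → ℝ := fun ε y => (1 + ε * ‖y‖ ^ 2)⁻¹
  have hψd : ∀ ε : ℝ, 0 < ε → ∀ y, HasFDerivAt (ψ ε)
      ((-((1 + ε * ‖y‖ ^ 2) ^ 2)⁻¹) • (ε • (2 • (innerSL ℝ y)))) y := by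
    intro ε hε y
    have hne : 1 + ε * ‖y‖ ^ 2 ≠ 0 := by positivity
    have h := (((hasStrictFDerivAt_norm_sq y).hasFDerivAt.const_mul ε).const_add 1)
    exact (hasDerivAt_inv hne).comp_hasFDerivAt y h
  have hψf : ∀ ε : ℝ, 0 < ε → ∀ y, fderiv ℝ (ψ ε) y v =
      -(2 * ε * ⟪y, v⟫ / (1 + ε * ‖y‖ ^ 2) ^ 2) := by
    intro ε hε y
    rw [(hψd ε hε y).fderiv]
    simp
    ring
  have hψc : ∀ ε : ℝ, 0 < ε → Continuous (ψ ε) := fun ε hε =>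
    continuous_iff_continuousAt.2 fun y => (hψd ε hε y).continuousAt
  have hψc' : ∀ ε : ℝ, 0 < ε → Continuous (fun y => fderiv ℝ (ψ ε) y v) := by
    intro ε hε
    rw [funext (hψf ε hε)]
    refine Continuous.neg (Continuous.div (by fun_prop) (by fun_prop) ?_)
    intro y; positivity
  have hψ1 : ∀ ε : ℝ, 0 < ε → ∀ y, ‖ψ ε y‖ ≤ 1 := by
    intro ε hε y
    have : 0 ≤ ε * ‖y‖ ^ 2 := by positivity
    rw [Real.norm_of_nonneg (by positivity)]
    exact inv_le_one_of_one_le₀ (by linarith)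
  have hbψ : ∀ ε : ℝ, 0 < ε → ∀ y, ‖ψ ε y * fderiv ℝ g y v‖ ≤ C * ‖v‖ * (1 + ‖y‖) ^ (-(n + 1)) := by
    intro ε hε y
    rw [norm_mul]
    calc _ ≤ 1 * ‖fderiv ℝ g y v‖ := by gcongr; exact hψ1 ε hε y
      _ ≤ _ := by rw [one_mul]; exact hb1 y
  have hbg : ∀ ε : ℝ, 0 < ε → ε ≤ 1 → ∀ y,
      ‖fderiv ℝ (ψ ε) y v * g y‖ ≤ 4 * ‖v‖ * C * (1 + ‖y‖) ^ (-(n + 1)) := by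
    intro ε hε hε1 y
    rw [norm_mul, hψf ε hε, norm_neg, norm_div, norm_mul, norm_mul, norm_pow,
      Real.norm_of_nonneg hε.le, Real.norm_of_nonneg (show (0:ℝ) ≤ 2 by norm_num),
      Real.norm_of_nonneg (show 0 ≤ 1 + ε * ‖y‖ ^ 2 by positivity), hJe]
    calc _ ≤ (2 * ε * (‖y‖ * ‖v‖) / (1 + ε * ‖y‖ ^ 2) ^ 2) * (C * (1 + ‖y‖) ^ (-n)) := by
          gcongr
          · exact norm_inner_le_norm y v
          · exact h0 y
      _ = (2 * ε * ‖y‖ / (1 + ε * ‖y‖ ^ 2) ^ 2) * (‖v‖ * C * (1 + ‖y‖) ^ (-n)) := by ring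
      _ ≤ (4 * (1 + ‖y‖)⁻¹) * (‖v‖ * C * (1 + ‖y‖) ^ (-n)) := by
          gcongr ?_ * _
          exact key_aux2 _ _ (norm_nonneg _) hε hε1
      _ = _ := by ring
  have hJ2 := hJ.const_mul (4 * ‖v‖ * C)
  have hibp : ∀ ε : ℝ, 0 < ε → ε ≤ 1 →
      ∫ y, ψ ε y * fderiv ℝ g y v = - ∫ y, fderiv ℝ (ψ ε) y v * g y := by
    intro ε hε hε1
    refine integral_mul_fderiv_eq_neg_fderiv_mul_of_integrable ?_ ?_ ?_ ?_ ?_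
    · exact hJ2.mono' ((hψc' ε hε).mul hg.continuous).aestronglyMeasurable
        (Filter.Eventually.of_forall (hbg ε hε hε1))
    · exact hJ1.mono' ((hψc ε hε).mul hdc).aestronglyMeasurable
        (Filter.Eventually.of_forall (hbψ ε hε))
    · refine (hJ.const_mul ((2 + 1 / ε) * C)).mono'
        ((hψc ε hε).mul hg.continuous).aestronglyMeasurable
        (Filter.Eventually.of_forall fun y => ?_)
      rw [norm_mul, hJe]
      calc _ ≤ ((2 + 1 / ε) * (1 + ‖y‖)⁻¹) * (C * (1 + ‖y‖) ^ (-n)) := by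
            gcongr
            · rw [Real.norm_of_nonneg (by positivity)]
              exact key_aux1 _ _ (norm_nonneg _) hε
            · exact h0 y
        _ = _ := by ring
    · exact fun y _ => (hψd ε hε y).differentiableAt
    · exact fun y _ => (hg.differentiable one_ne_zero) y
  let e : ℕ → ℝ := fun k => 1 / ((k : ℝ) + 1)
  have he : ∀ k, 0 < e k := fun k => by positivity
  have he1 : ∀ k, e k ≤ 1 := fun k => by
    have : (0:ℝ) ≤ k := by positivity
    exact (div_le_one (by positivity)).2 (by linarith)
  have het : Filter.Tendsto e Filter.atTop (nhds 0) := tendsto_one_div_add_atTop_nhds_zero_nat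
  have hL : Filter.Tendsto (fun k => ∫ y, ψ (e k) y * fderiv ℝ g y v) Filter.atTop
      (nhds (∫ y, fderiv ℝ g y v)) := by
    refine tendsto_integral_of_dominated_convergence _ (fun k =>
      ((hψc _ (he k)).mul hdc).aestronglyMeasurable) hJ1
      (fun k => Filter.Eventually.of_forall (hbψ _ (he k)))
      (Filter.Eventually.of_forall fun y => ?_)
    have hc : ContinuousAt (fun ε : ℝ => (1 + ε * ‖y‖ ^ 2)⁻¹ * fderiv ℝ g y v) 0 := by
      refine ContinuousAt.mul (ContinuousAt.inv₀ (by fun_prop) (by simp)) continuousAt_const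
    have := hc.tendsto.comp het
    simpa [Function.comp_def] using this
  have hR : Filter.Tendsto (fun k => ∫ y, fderiv ℝ (ψ (e k)) y v * g y) Filter.atTop
      (nhds (∫ _ : V, (0:ℝ))) := by
    refine tendsto_integral_of_dominated_convergence _ (fun k =>
      ((hψc' _ (he k)).mul hg.continuous).aestronglyMeasurable) hJ2
      (fun k => Filter.Eventually.of_forall (hbg _ (he k) (he1 k)))
      (Filter.Eventually.of_forall fun y => ?_)
    have hc : ContinuousAt (fun ε : ℝ => -(2 * ε * ⟪y, v⟫ / (1 + ε * ‖y‖ ^ 2) ^ 2) * g y) 0 := by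
      refine ContinuousAt.mul (ContinuousAt.neg (ContinuousAt.div (by fun_prop) (by fun_prop)
        (by simp))) continuousAt_const
    have := hc.tendsto.comp het
    simp only [hψf _ (he _)]
    simpa [Function.comp_def] using this
  rw [funext fun k => hibp _ (he k) (he1 k)] at hL
  have := tendsto_nhds_unique hL hR.neg
  simpa using this

/-- the componentwise Radon transform of a potential field `∇φ` is directed
along the normal `ω`. -/
theorem stmt8 (d : ℕ) (hd : 2 ≤ d)
    (φ : EuclideanSpace ℝ (Fin d) → ℝ) (hreg : ContDiff ℝ 1 φ)
    (C : ℝ) (hC : 0 ≤ C)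
    (hφb : ∀ x, |φ x| ≤ C * (1 + ‖x‖) ^ ((1 : ℝ) - d))
    (hgradb : ∀ x, ‖gradient φ x‖ ≤ C * (1 + ‖x‖) ^ (-(d : ℝ))) :
    ∀ ω : EuclideanSpace ℝ (Fin d), ‖ω‖ = 1 → ∀ p : ℝ,
      RadonVec (fun x => gradient φ x) ω p =
        (Dperp (fun x => gradient φ x) ω p) • ω := by
  intro ω hω p
  have hd' : (2:ℝ) ≤ d := by exact_mod_cast hd
  have hω0 : ω ≠ 0 := by
    rintro rfl
    simp at hω
  have hfr : (Module.finrank ℝ ((ℝ ∙ ω)ᗮ : Submodule ℝ (EuclideanSpace ℝ (Fin d))) : ℝ) + 1 = d := by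
    have h := Submodule.finrank_add_finrank_orthogonal (ℝ ∙ ω)
    rw [finrank_span_singleton hω0, finrank_euclideanSpace_fin] at h
    have h' : (Module.finrank ℝ ((ℝ ∙ ω)ᗮ : Submodule ℝ (EuclideanSpace ℝ (Fin d)))) + 1 = d := by
      omega
    exact_mod_cast h'
  have hnorm : ∀ y : ((ℝ ∙ ω)ᗮ : Submodule ℝ (EuclideanSpace ℝ (Fin d))),
      ‖y‖ ≤ ‖p • ω + (y : EuclideanSpace ℝ (Fin d))‖ := by
    intro y
    have ho : ⟪p • ω, (y : EuclideanSpace ℝ (Fin d))⟫ = 0 := by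
      rw [real_inner_smul_left, Submodule.mem_orthogonal_singleton_iff_inner_right.1 y.2, mul_zero]
    have h := norm_add_sq_eq_norm_sq_add_norm_sq_of_inner_eq_zero _ _ ho
    rw [Submodule.coe_norm]
    nlinarith [norm_nonneg (p • ω + (y : EuclideanSpace ℝ (Fin d))), mul_self_nonneg ‖p • ω‖,
      norm_nonneg (y : EuclideanSpace ℝ (Fin d))]
  have hmono : ∀ s : ℝ, s ≤ 0 → ∀ y : ((ℝ ∙ ω)ᗮ : Submodule ℝ (EuclideanSpace ℝ (Fin d))),
      C * (1 + ‖p • ω + (y : EuclideanSpace ℝ (Fin d))‖) ^ s ≤ C * (1 + ‖y‖) ^ s := by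
    intro s hs y
    refine mul_le_mul_of_nonneg_left ?_ hC
    exact Real.rpow_le_rpow_of_nonpos (by positivity) (by linarith [hnorm y]) hs
  have hgc : Continuous (gradient φ) :=
    (InnerProductSpace.toDual ℝ (EuclideanSpace ℝ (Fin d))).symm.continuous.comp
      (hreg.continuous_fderiv one_ne_zero)
  have hI : Integrable (fun y : ((ℝ ∙ ω)ᗮ : Submodule ℝ (EuclideanSpace ℝ (Fin d))) =>
      gradient φ (p • ω + (y : EuclideanSpace ℝ (Fin d)))) := by
    have hJ : Integrable (fun y : ((ℝ ∙ ω)ᗮ : Submodule ℝ (EuclideanSpace ℝ (Fin d))) =>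
        (1 + ‖y‖) ^ (-(d : ℝ))) := integrable_one_add_norm (by linarith)
    refine (hJ.const_mul C).mono' (hgc.comp (by fun_prop)).aestronglyMeasurable
      (Filter.Eventually.of_forall fun y => ?_)
    exact (hgradb _).trans (hmono _ (by linarith) y)
  have hinner : ∀ x w, ⟪w, gradient φ x⟫ = fderiv ℝ φ x w := by
    intro x w
    rw [real_inner_comm, gradient, InnerProductSpace.toDual_symm_apply]
  have hzero : ∀ v : ((ℝ ∙ ω)ᗮ : Submodule ℝ (EuclideanSpace ℝ (Fin d))),
      ∫ y : ((ℝ ∙ ω)ᗮ : Submodule ℝ (EuclideanSpace ℝ (Fin d))),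
        ⟪(v : EuclideanSpace ℝ (Fin d)), gradient φ (p • ω + (y : EuclideanSpace ℝ (Fin d)))⟫ = 0 := by
    intro v
    let ι := ((ℝ ∙ ω)ᗮ : Submodule ℝ (EuclideanSpace ℝ (Fin d))).subtypeL
    have hder : ∀ y : ((ℝ ∙ ω)ᗮ : Submodule ℝ (EuclideanSpace ℝ (Fin d))),
        HasFDerivAt (fun y : ((ℝ ∙ ω)ᗮ : Submodule ℝ (EuclideanSpace ℝ (Fin d))) =>
          φ (p • ω + (y : EuclideanSpace ℝ (Fin d))))
          ((fderiv ℝ φ (p • ω + (y : EuclideanSpace ℝ (Fin d)))).comp ι) y := by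
      intro y
      exact ((hreg.differentiable one_ne_zero) _).hasFDerivAt.comp y
        (ι.hasFDerivAt.const_add (p • ω))
    have hk := key_int (fun y : ((ℝ ∙ ω)ᗮ : Submodule ℝ (EuclideanSpace ℝ (Fin d))) =>
      φ (p • ω + (y : EuclideanSpace ℝ (Fin d))))
      (hreg.comp (contDiff_const.add ι.contDiff)) C hC ?_ ?_ v
    · rw [← hk]
      congr 1
      ext y
      rw [(hder y).fderiv, hinner]
      rfl
    · intro y
      refine (hφb _).trans ((hmono _ (by linarith) y).trans (le_of_eq ?_))
      congr 2
      linarith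
    · intro y
      rw [(hder y).fderiv, hfr]
      refine le_trans ?_ ((hgradb _).trans (hmono _ (by linarith) y))
      refine ContinuousLinearMap.opNorm_le_bound _ (norm_nonneg _) fun w => ?_
      have : ((fderiv ℝ φ (p • ω + (y : EuclideanSpace ℝ (Fin d)))).comp ι) w
        = ⟪(w : EuclideanSpace ℝ (Fin d)), gradient φ (p • ω + (y : EuclideanSpace ℝ (Fin d)))⟫ := by
        rw [hinner]; rfl
      rw [this, mul_comm]
      exact norm_inner_le_norm _ _
  have hin : ∀ w, ⟪w, RadonVec (fun x => gradient φ x) ω p⟫ =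
      ∫ y : ((ℝ ∙ ω)ᗮ : Submodule ℝ (EuclideanSpace ℝ (Fin d))),
        ⟪w, gradient φ (p • ω + (y : EuclideanSpace ℝ (Fin d)))⟫ := by
    intro w
    exact (integral_inner hI w).symm
  have hmem : RadonVec (fun x => gradient φ x) ω p ∈ ℝ ∙ ω := by
    rw [← Submodule.orthogonal_orthogonal (ℝ ∙ ω), Submodule.mem_orthogonal]
    intro u hu
    rw [hin u]
    exact hzero ⟨u, hu⟩
  obtain ⟨c, hc⟩ := Submodule.mem_span_singleton.1 hmem
  have h1 := hin ω
  rw [← hc, real_inner_smul_right, real_inner_self_eq_norm_sq, hω] at h1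
  rw [← hc]
  congr 1
  unfold Dperp RadonT
  rw [← h1]
  ring
end
end
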